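/- arXiv:2211.03503 — 2 statements merged into one kernel-verified Lean document; each statement's English description precedes it below -/
import Mathlib

section
/- Theorem (main): Let (X,f) be a dynamical system with the shadowing property, Y ⊆ X a chain recurrent class, and Φ : X → ℝ continuous. If there exist ergodic f-invariant measures μ_1, μ_2 supported in Y with ∫Φ dμ_1 ≠ ∫Φ dμ_2, then for every ε > 0 the set S = I_Φ(f) ∩ B(Y,ε) ∩ CR(f) is nonempty and h_S(f) ≥ h_Y(f), where h denotes Bowen topological entropy of a (possibly noncompact) set. -/
open Filter Topology MeasureTheory Set
open scoped ENNReal NNReal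

variable {X : Type*} [MetricSpace X]

/-- `x` is in the chain stable set of `y` at scale `ε`: there is a finite sequence of
points starting at `x`, ending at `y`, and positive iteration times `t i` with
`d(f^[t i] (x i), x (i+1)) < ε`. -/
def ChainStable (f : X → X) (ε : ℝ) (x y : X) : Prop :=
  ∃ (n : ℕ) (c : ℕ → X) (t : ℕ → ℕ), 1 ≤ n ∧ c 0 = x ∧ c n = y ∧
    ∀ i < n, 1 ≤ t i ∧ dist (f^[t i] (c i)) (c (i + 1)) < ε

/-- `x` and `y` are chain related: each is in the chain stable set of the other for every `ε > 0`. -/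
def ChainRelated (f : X → X) (x y : X) : Prop :=
  ∀ ε : ℝ, 0 < ε → ChainStable f ε x y ∧ ChainStable f ε y x

/-- The set of chain recurrent points. -/
def ChainRecurrent (f : X → X) : Set X := {x | ChainRelated f x x}

/-- The chain recurrent class of a point `y`. -/
def ChainClassOf (f : X → X) (y : X) : Set X :=
  {x ∈ ChainRecurrent f | ChainRelated f x y}

/-- `Y` is a chain recurrent class. -/
def IsChainClass (f : X → X) (Y : Set X) : Prop :=
  ∃ y ∈ ChainRecurrent f, Y = ChainClassOf f y

/-- `x` is a nonwandering point of `f`. -/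
def NonWandering (f : X → X) (x : X) : Prop :=
  ∀ U : Set X, IsOpen U → x ∈ U → ∃ k : ℕ, 1 ≤ k ∧ (f^[k] '' U ∩ U).Nonempty

/-- `f` has the shadowing property. -/
def ShadowingProperty (f : X → X) : Prop :=
  ∀ ε : ℝ, 0 < ε → ∃ δ : ℝ, 0 < δ ∧ ∀ z : ℕ → X,
    (∀ n, dist (f (z n)) (z (n + 1)) < δ) → ∃ y : X, ∀ n, dist (f^[n] y) (z n) < ε

/-- `q` is a minimal point: its orbit closure is a minimal set. -/
def MinimalPoint (f : X → X) (q : X) : Prop :=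
  ∀ p ∈ closure (Set.range fun n => f^[n] q),
    closure (Set.range fun n => f^[n] p) = closure (Set.range fun n => f^[n] q)

/-- The `(n,ε)`-Bowen ball around `x`. -/
def bowenBall (f : X → X) (n : ℕ) (x : X) (ε : ℝ) : Set X :=
  {y | ∀ i < n, dist (f^[i] x) (f^[i] y) < ε}

/-- `C(Z,t,n,ε,f)`: infimum over countable covers of `Z` by Bowen balls `B_v(x,ε)`, `v ≥ n`,
of `Σ e^{-t v}`. -/
noncomputable def bowenC (f : X → X) (Z : Set X) (t ε : ℝ) (n : ℕ) : ℝ≥0∞ :=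
  ⨅ (c : ℕ → X) (v : ℕ → ℕ) (_ : ∀ i, n ≤ v i)
    (_ : Z ⊆ ⋃ i, bowenBall f (v i) (c i) ε),
    ∑' i, ENNReal.ofReal (Real.exp (-t * v i))

/-- `C(Z,t,ε,f) = lim_{n→∞} C(Z,t,n,ε,f)` (the limit is a supremum by monotonicity). -/
noncomputable def bowenCLim (f : X → X) (Z : Set X) (t ε : ℝ) : ℝ≥0∞ :=
  ⨆ n, bowenC f Z t ε n

/-- Bowen entropy of `Z` at scale `ε`: `inf {t : C(Z,t,ε,f) = 0}`, valued in `[0,∞]`. -/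
noncomputable def bowenH (f : X → X) (Z : Set X) (ε : ℝ) : ℝ≥0∞ :=
  sInf (ENNReal.ofReal '' {t : ℝ | bowenCLim f Z t ε = 0})

/-- Bowen topological entropy of `Z`: `lim_{ε→0} h_Z(f,ε)`, a supremum by monotonicity. -/
noncomputable def bowenEntropy (f : X → X) (Z : Set X) : ℝ≥0∞ :=
  ⨆ (ε : ℝ) (_ : 0 < ε), bowenH f Z ε

/-- Upper relative metric mean dimension of `Z`: `limsup_{ε→0⁺} h_Z(f,ε)/(-log ε)`. -/
noncomputable def upperMdim (f : X → X) (Z : Set X) : ℝ≥0∞ :=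
  Filter.limsup (fun ε : ℝ => bowenH f Z ε / ENNReal.ofReal (-Real.log ε))
    (nhdsWithin 0 (Set.Ioi 0))

/-- Lower relative metric mean dimension of `Z`: `liminf_{ε→0⁺} h_Z(f,ε)/(-log ε)`. -/
noncomputable def lowerMdim (f : X → X) (Z : Set X) : ℝ≥0∞ :=
  Filter.liminf (fun ε : ℝ => bowenH f Z ε / ENNReal.ofReal (-Real.log ε))
    (nhdsWithin 0 (Set.Ioi 0))

/-- Birkhoff average `(1/n) Σ_{i<n} Φ(f^i x)`. -/
noncomputable def birkhoffAvg (f : X → X) (Φ : X → ℝ) (n : ℕ) (x : X) : ℝ :=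
  (1 / (n : ℝ)) * ∑ i ∈ Finset.range n, Φ (f^[i] x)

/-- The `Φ`-irregular set: points where the Birkhoff averages of `Φ` diverge. -/
def IrregularSet (f : X → X) (Φ : X → ℝ) : Set X :=
  {x | ¬ ∃ L : ℝ, Tendsto (fun n => birkhoffAvg f Φ n x) atTop (nhds L)}

/-- A `δ`-pseudo-orbit segment of length `n` from `u` to `v`. -/
def IsPath (f : X → X) (δ : ℝ) (n : ℕ) (u v : X) (w : ℕ → X) : Prop :=
  w 0 = u ∧ w n = v ∧ ∀ i < n, dist (f (w i)) (w (i + 1)) < δ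

/-- Concatenation of segments. -/
def pcat {X : Type*} (n : ℕ) (w w' : ℕ → X) : ℕ → X := fun i => if i < n then w i else w' (i - n)

theorem IsPath.cat {f : X → X} {δ : ℝ} {n n' : ℕ} {u v x : X} {w w' : ℕ → X}
    (h : IsPath f δ n u v w) (h' : IsPath f δ n' v x w') :
    IsPath f δ (n + n') u x (pcat n w w') := by
  obtain ⟨h0, h1, h2⟩ := h
  obtain ⟨h0', h1', h2'⟩ := h'
  refine ⟨?_, ?_, ?_⟩
  · unfold pcat
    split_ifs with hn
    · exact h0
    · have : n = 0 := by omega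
      subst this
      simp [h0', ← h1, h0]
  · simp [pcat, h1']
  · intro i hi
    unfold pcat
    by_cases hin : i < n
    · by_cases hin' : i + 1 < n
      · simpa [hin, hin'] using h2 i hin
      · have : i + 1 = n := by omega
        have h3 := h2 i hin
        rw [this, h1] at h3
        simpa [hin, this, h0'] using h3
    · have h3 := h2' (i - n) (by omega)
      have h4 : ¬ (i + 1 < n) := by omega
      have h5 : i + 1 - n = i - n + 1 := by omega
      simpa [hin, h4, h5] using h3

theorem pcat_sum {X : Type*} (Φ : X → ℝ) (n n' : ℕ) (w w' : ℕ → X) :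
    ∑ i ∈ Finset.range (n + n'), Φ (pcat n w w' i) =
      ∑ i ∈ Finset.range n, Φ (w i) + ∑ i ∈ Finset.range n', Φ (w' i) := by
  rw [Finset.sum_range_add]
  congr 1
  · refine Finset.sum_congr rfl fun i hi => ?_
    rw [Finset.mem_range] at hi
    simp [pcat, hi]
  · refine Finset.sum_congr rfl fun i hi => ?_
    simp [pcat]

theorem isPath_orbit (f : X → X) {δ : ℝ} (hδ : 0 < δ) (n : ℕ) (x : X) :
    IsPath f δ n x (f^[n] x) (fun i => f^[i] x) := by
  refine ⟨rfl, rfl, fun i _ => ?_⟩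
  simp [Function.iterate_succ_apply', hδ]

theorem IsPath.rep {f : X → X} {δ : ℝ} {n : ℕ} {b : X} {w : ℕ → X}
    (h : IsPath f δ n b b w) (Φ : X → ℝ) (k : ℕ) :
    ∃ w', IsPath f δ (k * n) b b w' ∧
      ∑ i ∈ Finset.range (k * n), Φ (w' i) = k * ∑ i ∈ Finset.range n, Φ (w i) := by
  induction k with
  | zero => exact ⟨fun _ => b, ⟨rfl, rfl, by simp⟩, by simp⟩
  | succ k ih =>
    obtain ⟨w', hw', hs⟩ := ih
    refine ⟨pcat (k * n) w' w, ?_, ?_⟩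
    · rw [Nat.succ_mul]; exact hw'.cat h
    · rw [Nat.succ_mul, pcat_sum, hs]; push_cast; ring

/-- Changing the last point. -/
theorem IsPath.replace_last {f : X → X} {δ δ' : ℝ} {n : ℕ} {u v v' : X} {w : ℕ → X}
    (h : IsPath f δ n u v w) (hn : 1 ≤ n) (hd : 0 ≤ δ') (hv : dist v v' ≤ δ') :
    ∃ w', IsPath f (δ + δ') n u v' w' := by
  obtain ⟨h0, h1, h2⟩ := h
  refine ⟨Function.update w n v', ?_, by simp, ?_⟩
  · rw [Function.update_of_ne (by omega), h0]
  · intro i hi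
    rw [Function.update_of_ne (by omega)]
    by_cases hin : i + 1 = n
    · rw [hin, Function.update_self]
      have h3 := h2 i hi
      rw [hin, h1] at h3
      linarith [dist_triangle (f (w i)) v v']
    · rw [Function.update_of_ne hin]
      linarith [h2 i hi]

/-- Changing the first point. -/
theorem IsPath.replace_first {f : X → X} {δ δ' : ℝ} {n : ℕ} {u v u' : X} {w : ℕ → X}
    (h : IsPath f δ n u v w) (hn : 1 ≤ n) (hd : 0 ≤ δ') (hv : dist (f u') (f u) ≤ δ') :
    ∃ w', IsPath f (δ + δ') n u' v w' := by
  obtain ⟨h0, h1, h2⟩ := h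
  refine ⟨Function.update w 0 u', by simp, ?_, ?_⟩
  · rw [Function.update_of_ne (by omega), h1]
  · intro i hi
    rw [Function.update_of_ne (by omega : i + 1 ≠ 0)]
    by_cases hin : i = 0
    · subst hin
      rw [Function.update_self]
      have h3 := h2 0 hi
      rw [h0] at h3
      linarith [dist_triangle (f u') (f u) (w (0 + 1))]
    · rw [Function.update_of_ne hin]
      linarith [h2 i hi]

theorem ChainStable.exists_path {f : X → X} {δ : ℝ} (hδ : 0 < δ) {x y : X}
    (h : ChainStable f δ x y) : ∃ n, 1 ≤ n ∧ ∃ w, IsPath f δ n x y w := by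
  obtain ⟨n, c, t, hn, h0, h1, h2⟩ := h
  have key : ∀ k, k ≤ n → ∃ m, k ≤ m ∧ ∃ w, IsPath f δ m (c 0) (c k) w := by
    intro k
    induction k with
    | zero => intro _; exact ⟨0, le_rfl, fun _ => c 0, rfl, rfl, by simp⟩
    | succ k ih =>
      intro hk
      obtain ⟨m, hm, w, hw⟩ := ih (by omega)
      obtain ⟨ht, hd⟩ := h2 k (by omega)
      have hstep : IsPath f δ (t k) (c k) (c (k + 1))
          (fun i => if i < t k then f^[i] (c k) else c (k + 1)) := by
        refine ⟨by simp; omega, by simp, fun i hi => ?_⟩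
        by_cases hi' : i + 1 < t k
        · simp [hi, hi', ← Function.iterate_succ_apply' f i, hδ]
        · have : t k = i + 1 := by omega
          rw [this] at hd ⊢
          simpa [← Function.iterate_succ_apply' f i] using hd
      exact ⟨m + t k, by omega, _, hw.cat hstep⟩
  obtain ⟨m, hm, w, hw⟩ := key n le_rfl
  rw [h0, h1] at hw
  exact ⟨m, by omega, w, hw⟩

/-- Points chain-connected to the base point `b` in both directions. -/
def Good (f : X → X) (b x : X) : Prop :=
  ∀ δ : ℝ, 0 < δ → (∃ n, 1 ≤ n ∧ ∃ w, IsPath f δ n b x w) ∧ (∃ n, 1 ≤ n ∧ ∃ w, IsPath f δ n x b w)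

theorem Good.map {f : X → X} (hf : Continuous f) {b x : X} (hb : Good f b b) (hx : Good f b x) :
    Good f b (f x) := by
  intro δ hδ
  constructor
  · obtain ⟨n, hn, w, hw⟩ := (hx δ hδ).1
    exact ⟨n + 1, by omega, _, hw.cat (isPath_orbit f hδ 1 x)⟩
  · obtain ⟨r, hr, hr'⟩ := Metric.continuous_iff.1 hf (f x) (δ / 2) (by linarith)
    set ρ := min r (δ / 2) with hρ
    have hρ0 : 0 < ρ := lt_min hr (by linarith)
    obtain ⟨n, hn, w, hw⟩ := (hx ρ hρ0).2
    obtain ⟨n', hn', w', hw'⟩ := (hb ρ hρ0).2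
    obtain ⟨h0, h1, h2⟩ := hw.cat hw'
    set W := pcat n w w' with hW
    have hpath : IsPath f ρ (n + n' - 1) (W 1) b (fun i => W (i + 1)) := by
      refine ⟨rfl, ?_, fun i hi => h2 (i + 1) (by omega)⟩
      show W (n + n' - 1 + 1) = b
      rw [Nat.sub_add_cancel (by omega), h1]
    have h3 : dist (W 1) (f x) < r := by
      have := h2 0 (by omega)
      rw [h0] at this
      rw [dist_comm]
      exact this.trans_le (min_le_left _ _)
    obtain ⟨w'', hw''⟩ := hpath.replace_first (by omega) (δ' := δ / 2) (by linarith)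
      (u' := f x) (by rw [dist_comm]; exact (hr' _ h3).le)
    refine ⟨n + n' - 1, by omega, w'', hw''.1, hw''.2.1, fun i hi => ?_⟩
    linarith [hw''.2.2 i hi, min_le_right r (δ / 2)]

theorem Good.iter {f : X → X} (hf : Continuous f) {b x : X} (hb : Good f b b) (hx : Good f b x)
    (n : ℕ) : Good f b (f^[n] x) := by
  induction n with
  | zero => exact hx
  | succ n ih => rw [Function.iterate_succ_apply']; exact Good.map hf hb ih

theorem good_uniform [CompactSpace X] {f : X → X} (hf : Continuous f) (b : X) {δ : ℝ}
    (hδ : 0 < δ) : ∃ L : ℕ, ∀ x, Good f b x →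
      (∃ n ≤ L, ∃ w, IsPath f δ n b x w) ∧ (∃ n ≤ L, ∃ w, IsPath f δ n x b w) := by
  have huc := CompactSpace.uniformContinuous_of_continuous hf
  obtain ⟨r, hr, hr'⟩ := Metric.uniformContinuous_iff.1 huc (δ / 2) (by linarith)
  set ρ := min r (δ / 2) with hρ
  have hρ0 : 0 < ρ := lt_min hr (by linarith)
  have htb : TotallyBounded {x | Good f b x} := isCompact_univ.totallyBounded.subset (subset_univ _)
  obtain ⟨s, hs, hsf, hcov⟩ := Metric.finite_approx_of_totallyBounded htb ρ hρ0
  have h1 : ∀ y ∈ s, ∃ L : ℕ, (∃ n, (1 ≤ n ∧ n ≤ L) ∧ ∃ w, IsPath f (δ / 2) n b y w) ∧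
      (∃ n, (1 ≤ n ∧ n ≤ L) ∧ ∃ w, IsPath f (δ / 2) n y b w) := by
    intro y hy
    obtain ⟨⟨n, hn, hw⟩, n', hn', hw'⟩ := hs hy (δ / 2) (by linarith)
    exact ⟨n + n', ⟨n, ⟨hn, by omega⟩, hw⟩, n', ⟨hn', by omega⟩, hw'⟩
  choose! L hL using h1
  obtain ⟨B, hB⟩ := (hsf.image L).bddAbove
  refine ⟨B, fun x hx => ?_⟩
  obtain ⟨y, hy, hxy⟩ := mem_iUnion₂.1 (hcov hx)
  rw [Metric.mem_ball] at hxy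
  have hLB : L y ≤ B := hB ⟨y, hy, rfl⟩
  obtain ⟨⟨n, ⟨hn, hn2⟩, w, hw⟩, n', ⟨hn', hn2'⟩, w', hw'⟩ := hL y hy
  constructor
  · obtain ⟨w2, hw2⟩ := hw.replace_last hn (δ' := δ / 2) (by linarith) (v' := x)
      (by rw [dist_comm]; exact hxy.le.trans (min_le_right _ _))
    rw [add_halves] at hw2
    exact ⟨n, by omega, w2, hw2⟩
  · obtain ⟨w2, hw2⟩ := hw'.replace_first hn' (δ' := δ / 2) (by linarith) (u' := x)
      (hr' (hxy.trans_le (min_le_left _ _))).le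
    rw [add_halves] at hw2
    exact ⟨n', by omega, w2, hw2⟩

/-- A point of `Y` with large Birkhoff sum. -/
theorem exists_large_sum [CompactSpace X] [MeasurableSpace X] [BorelSpace X]
    {f : X → X} {Y : Set X} {Φ : X → ℝ} (hf : Continuous f) (hΦ : Continuous Φ)
    (μ : Measure X) (hp : IsProbabilityMeasure μ) (he : MeasurePreserving f μ μ) (hμY : μ Y = 1)
    (k : ℕ) : ∃ x ∈ Y, k * ∫ x, Φ x ∂μ ≤ ∑ i ∈ Finset.range k, Φ (f^[i] x) := by
  have hcont : ∀ i : ℕ, Continuous fun x => Φ (f^[i] x) := fun i => hΦ.comp (hf.iterate i)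
  have hintg : ∀ g : X → ℝ, Continuous g → Integrable g μ := fun g hg =>
    hg.integrable_of_hasCompactSupport (HasCompactSupport.of_compactSpace g)
  have hS : Continuous fun x => ∑ i ∈ Finset.range k, Φ (f^[i] x) :=
    continuous_finsetSum _ fun i _ => hcont i
  have hval : ∫ x, ∑ i ∈ Finset.range k, Φ (f^[i] x) ∂μ = k * ∫ x, Φ x ∂μ := by
    rw [integral_finsetSum _ fun i _ => hintg _ (hcont i)]
    have : ∀ i ∈ Finset.range k, ∫ x, Φ (f^[i] x) ∂μ = ∫ x, Φ x ∂μ := by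
      intro i _
      have hmp := he.iterate i
      conv_rhs => rw [← hmp.map_eq]
      rw [integral_map hmp.measurable.aemeasurable hΦ.aestronglyMeasurable]
    rw [Finset.sum_congr rfl this]
    simp
  have hpos := measure_integral_le_pos (hintg _ hS)
  rw [hval] at hpos
  by_contra hcon
  push Not at hcon
  have hmeas : MeasurableSet {x | (k : ℝ) * ∫ x, Φ x ∂μ ≤ ∑ i ∈ Finset.range k, Φ (f^[i] x)} :=
    (isClosed_le continuous_const hS).measurableSet
  have hsub : Y ⊆ {x | (k : ℝ) * ∫ x, Φ x ∂μ ≤ ∑ i ∈ Finset.range k, Φ (f^[i] x)}ᶜ := by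
    intro x hx
    simpa using hcon x hx
  have h1 : μ {x | (k : ℝ) * ∫ x, Φ x ∂μ ≤ ∑ i ∈ Finset.range k, Φ (f^[i] x)}ᶜ = 1 :=
    le_antisymm prob_le_one (hμY ▸ measure_mono hsub)
  rw [prob_compl_eq_one_iff hmeas] at h1
  exact hpos.ne h1.symm

/-- Marker loop with large average. -/
theorem exists_marker [CompactSpace X] {f : X → X} {Φ : X → ℝ} (hf : Continuous f)
    {b : X} (hb : Good f b b) {M : ℝ} (hM : ∀ x, |Φ x| ≤ M)
    {δ γ α : ℝ} (hδ : 0 < δ) (hγ : 0 < γ)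
    (hα : ∀ k : ℕ, ∃ x, Good f b x ∧ k * α ≤ ∑ i ∈ Finset.range k, Φ (f^[i] x)) :
    ∃ l : ℕ, 1 ≤ l ∧ ∃ w, IsPath f δ l b b w ∧
      l * (α - γ) ≤ ∑ i ∈ Finset.range l, Φ (w i) := by
  obtain ⟨L, hL⟩ := good_uniform hf b hδ
  obtain ⟨k, hk⟩ := exists_nat_gt ((2 * L * (M + |α|)) / γ)
  have hM0 : 0 ≤ M := (abs_nonneg _).trans (hM b)
  have hk0 : 1 ≤ k := by
    have : (0:ℝ) < k := lt_of_le_of_lt (by positivity) hk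
    exact_mod_cast this
  rw [div_lt_iff₀ hγ] at hk
  obtain ⟨x, hx, hsum⟩ := hα k
  obtain ⟨n₁, hn₁, w₁, hw₁⟩ := (hL x hx).1
  obtain ⟨n₂, hn₂, w₂, hw₂⟩ := (hL _ (Good.iter hf hb hx k)).2
  refine ⟨n₁ + (k + n₂), by omega, _, hw₁.cat ((isPath_orbit f hδ k x).cat hw₂), ?_⟩
  rw [pcat_sum, pcat_sum]
  have hlow : ∀ (n : ℕ) (w : ℕ → X), -(n * M) ≤ ∑ i ∈ Finset.range n, Φ (w i) := by
    intro n w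
    have : ∑ i ∈ Finset.range n, (-M) ≤ ∑ i ∈ Finset.range n, Φ (w i) :=
      Finset.sum_le_sum fun i _ => (abs_le.1 (hM (w i))).1
    simpa using this
  have h1 := hlow n₁ w₁
  have h2 := hlow n₂ w₂
  push_cast
  have hn₁' : (n₁ : ℝ) ≤ L := by exact_mod_cast hn₁
  have hn₂' : (n₂ : ℝ) ≤ L := by exact_mod_cast hn₂
  have e1 : (n₁ + n₂ : ℝ) * (M + |α|) ≤ 2 * L * (M + |α|) := by
    apply mul_le_mul_of_nonneg_right _ (by positivity); linarith
  have e2 : (n₁ + n₂ : ℝ) * α ≤ (n₁ + n₂ : ℝ) * |α| :=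
    mul_le_mul_of_nonneg_left (le_abs_self α) (by positivity)
  have e3 : 0 ≤ (n₁ + n₂ : ℝ) * γ := by positivity
  nlinarith

/-- omega-limit points are chain recurrent. -/
theorem chainRecurrent_of_limit {f : X → X} (hf : Continuous f) {x y : X} {n : ℕ → ℕ}
    (hn : Tendsto n atTop atTop) (hy : Tendsto (fun k => f^[n k] x) atTop (𝓝 y)) :
    y ∈ ChainRecurrent f := by
  have key : ∀ δ : ℝ, 0 < δ → ChainStable f δ y y := by
    intro δ hδ
    have h1 : Tendsto (fun k => f (f^[n k] x)) atTop (𝓝 (f y)) := (hf.tendsto y).comp hy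
    obtain ⟨k, hk⟩ := ((Metric.tendsto_nhds.1 h1) δ hδ).exists
    obtain ⟨k', hk', hk2⟩ := (((Metric.tendsto_nhds.1 hy) δ hδ).and
      (hn.eventually_ge_atTop (n k + 2))).exists
    refine ⟨2, fun i => if i = 1 then f (f^[n k] x) else y, fun i => if i = 0 then 1 else
      n k' - n k - 1, by norm_num, by simp, by simp, ?_⟩
    intro i hi
    interval_cases i
    · simpa [dist_comm] using hk
    · refine ⟨by simp; omega, ?_⟩
      simp only [if_true, one_ne_zero, if_false]
      rw [← Function.iterate_succ_apply' f, ← Function.iterate_add_apply]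
      have : n k' - n k - 1 + (n k).succ = n k' := by omega
      rw [this]
      simpa using hk'
  exact fun δ hδ => ⟨key δ hδ, key δ hδ⟩

/-- The pseudo-orbit obtained by concatenating loops of length `T`. -/
def conc {X A : Type*} (T : ℕ) (W : A → ℕ → X) (s : ℕ → A) : ℕ → X := fun i => W (s (i / T)) (i % T)

theorem conc_pseudo {A : Type*} {f : X → X} {δ : ℝ} {T : ℕ} (hT : 1 ≤ T) {b : X}
    {W : A → ℕ → X} (hW : ∀ a, IsPath f δ T b b (W a)) (s : ℕ → A) (i : ℕ) :
    dist (f (conc T W s i)) (conc T W s (i + 1)) < δ := by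
  unfold conc
  obtain ⟨h0, h1, h2⟩ := hW (s (i / T))
  have hlt : i % T < T := Nat.mod_lt _ hT
  have h3 := h2 (i % T) hlt
  have hi := Nat.div_add_mod i T
  by_cases h : i % T + 1 < T
  · have e : i + 1 = (i % T + 1) + T * (i / T) := by omega
    have e1 : (i + 1) / T = i / T := by
      rw [e, Nat.add_mul_div_left _ _ hT, Nat.div_eq_of_lt h, zero_add]
    have e2 : (i + 1) % T = i % T + 1 := by
      rw [e, Nat.add_mul_mod_self_left, Nat.mod_eq_of_lt h]
    rw [e1, e2]; exact h3
  · have h' : i % T + 1 = T := by omega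
    have e : i + 1 = T * (i / T + 1) := by rw [mul_add]; omega
    have e2 : (i + 1) % T = 0 := by rw [e, Nat.mul_mod_right]
    rw [e2, (hW _).1]
    rw [h', h1] at h3
    exact h3

theorem exists_cr_shadow [CompactSpace X] {A : Type*} {f : X → X} (hf : Continuous f)
    {δ ε' : ℝ} (hsh : ∀ z : ℕ → X, (∀ n, dist (f (z n)) (z (n + 1)) < δ) →
      ∃ y : X, ∀ n, dist (f^[n] y) (z n) < ε')
    {T : ℕ} (hT : 1 ≤ T) {b : X}
    {W : A → ℕ → X} (hW : ∀ a, IsPath f δ T b b (W a)) (s : ℕ → A) :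
    ∃ y ∈ ChainRecurrent f, ∀ i, dist (f^[i] y) (conc T W s i) ≤ ε' := by
  set u : ℕ → A := fun p => s (p - 2 ^ Nat.log 2 p) with hu
  obtain ⟨x, hx⟩ := hsh (conc T W u) (conc_pseudo hT hW u)
  obtain ⟨y, -, φ, hφ, hy⟩ := isCompact_univ.tendsto_subseq
    (x := fun k => f^[2 ^ k * T] x) (fun _ => mem_univ _)
  have hn : Tendsto (fun k => 2 ^ φ k * T) atTop atTop := by
    refine tendsto_atTop_mono (fun k => ?_) hφ.tendsto_atTop
    calc φ k ≤ 2 ^ φ k := Nat.lt_two_pow_self.le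
      _ = 2 ^ φ k * 1 := (mul_one _).symm
      _ ≤ 2 ^ φ k * T := Nat.mul_le_mul_left _ hT
  refine ⟨y, chainRecurrent_of_limit hf hn hy, fun i => ?_⟩
  have h1 : Tendsto (fun k => f^[i] (f^[2 ^ φ k * T] x)) atTop (𝓝 (f^[i] y)) :=
    ((hf.iterate i).tendsto y).comp hy
  have h2 := h1.dist (tendsto_const_nhds (x := conc T W s i))
  refine le_of_tendsto h2 ?_
  filter_upwards [hn.eventually_gt_atTop i] with k hk
  have h3 := hx (i + 2 ^ φ k * T)
  rw [Function.iterate_add_apply] at h3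
  have h4 : conc T W u (i + 2 ^ φ k * T) = conc T W s i := by
    unfold conc
    rw [Nat.add_mul_div_right _ _ hT, Nat.add_mul_mod_self_right]
    have hlt : i / T < 2 ^ φ k := Nat.div_lt_of_lt_mul (by rwa [mul_comm])
    have hlog : Nat.log 2 (i / T + 2 ^ φ k) = φ k := by
      rw [Nat.log_eq_iff (Or.inr ⟨by norm_num, by positivity⟩)]
      constructor
      · exact Nat.le_add_left _ _
      · rw [pow_succ, mul_two]; exact Nat.add_lt_add_right hlt _
    simp only [hu]
    rw [hlog, Nat.add_sub_cancel]
  rw [h4] at h3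
  exact h3.le

/-- Irregularity criterion. -/
theorem irregular_of_blocks {f : X → X} {Φ : X → ℝ} {y : X} {T : ℕ} (hT : 1 ≤ T) {B₁ B₂ : ℝ}
    (hB : B₂ < B₁)
    (h₁ : ∀ j, Nat.log 2 j % 2 = 0 → B₁ ≤ ∑ i ∈ Finset.range T, Φ (f^[j * T + i] y))
    (h₂ : ∀ j, Nat.log 2 j % 2 = 1 → ∑ i ∈ Finset.range T, Φ (f^[j * T + i] y) ≤ B₂) :
    y ∈ IrregularSet f Φ := by
  rintro ⟨L, hL⟩
  set S : ℕ → ℝ := fun n => ∑ i ∈ Finset.range n, Φ (f^[i] y) with hS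
  have hblock : ∀ m, S (m * T) = ∑ j ∈ Finset.range m, ∑ i ∈ Finset.range T, Φ (f^[j * T + i] y) := by
    intro m
    induction m with
    | zero => simp [hS]
    | succ m ih =>
      rw [Finset.sum_range_succ, ← ih, Nat.succ_mul]
      simp only [hS]
      rw [Finset.sum_range_add]
  have hT0 : (0:ℝ) < T := by exact_mod_cast hT
  have htend : Tendsto (fun k : ℕ => 2 ^ k * T) atTop atTop := by
    refine tendsto_atTop_mono (fun k => ?_) tendsto_id
    calc id k ≤ 2 ^ k := Nat.lt_two_pow_self.le
      _ = 2 ^ k * 1 := (mul_one _).symm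
      _ ≤ 2 ^ k * T := Nat.mul_le_mul_left _ hT
  have hA : Tendsto (fun k : ℕ => birkhoffAvg f Φ (2 ^ k * T) y) atTop (𝓝 L) := hL.comp htend
  have hA' := hA.comp (tendsto_add_atTop_nat 1)
  have hD := ((hA'.const_mul 2).sub hA).const_mul (T : ℝ)
  rw [show (T : ℝ) * (2 * L - L) = T * L by ring] at hD
  have hval : ∀ k : ℕ, (T : ℝ) * (2 * birkhoffAvg f Φ (2 ^ (k + 1) * T) y -
      birkhoffAvg f Φ (2 ^ k * T) y) =
      (∑ j ∈ Finset.range (2 ^ k), ∑ i ∈ Finset.range T, Φ (f^[(2 ^ k + j) * T + i] y)) / 2 ^ k := by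
    intro k
    have e1 : birkhoffAvg f Φ (2 ^ (k + 1) * T) y = 1 / (2 ^ (k + 1) * T) * S (2 ^ (k + 1) * T) := by
      simp [birkhoffAvg, hS]
    have e2 : birkhoffAvg f Φ (2 ^ k * T) y = 1 / (2 ^ k * T) * S (2 ^ k * T) := by
      simp [birkhoffAvg, hS]
    rw [e1, e2, hblock, hblock, show 2 ^ (k + 1) = 2 ^ k + 2 ^ k by ring, Finset.sum_range_add]
    field_simp
    ring
  have hlog : ∀ k j : ℕ, j < 2 ^ k → Nat.log 2 (2 ^ k + j) = k := by
    intro k j hj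
    rw [Nat.log_eq_iff (Or.inr ⟨by norm_num, by positivity⟩)]
    exact ⟨by omega, by rw [pow_succ]; omega⟩
  have hev : Tendsto (fun k : ℕ => 2 * k) atTop atTop :=
    tendsto_atTop_mono (fun k => by simp; omega) tendsto_id
  have hod : Tendsto (fun k : ℕ => 2 * k + 1) atTop atTop :=
    tendsto_atTop_mono (fun k => by simp; omega) tendsto_id
  have l1 : B₁ ≤ T * L := by
    refine ge_of_tendsto' (hD.comp hev) fun k => ?_
    simp only [Function.comp]
    rw [hval, le_div_iff₀ (by positivity)]
    have := Finset.card_nsmul_le_sum (Finset.range (2 ^ (2 * k)))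
      (fun j => ∑ i ∈ Finset.range T, Φ (f^[(2 ^ (2 * k) + j) * T + i] y)) B₁ (by
        intro j hj
        apply h₁
        rw [hlog _ _ (Finset.mem_range.1 hj)]; omega)
    simpa [mul_comm] using this
  have l2 : T * L ≤ B₂ := by
    refine le_of_tendsto' (hD.comp hod) fun k => ?_
    simp only [Function.comp]
    rw [hval, div_le_iff₀ (by positivity)]
    have := Finset.sum_le_card_nsmul (Finset.range (2 ^ (2 * k + 1)))
      (fun j => ∑ i ∈ Finset.range T, Φ (f^[(2 ^ (2 * k + 1) + j) * T + i] y)) B₂ (by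
        intro j hj
        apply h₂
        rw [hlog _ _ (Finset.mem_range.1 hj)]; omega)
    simpa [mul_comm] using this
  linarith

/-- Mass distribution principle for the full shift coding. -/
theorem bowenCLim_ne_zero_of_coding {ι : Type*} [Fintype ι] [Nonempty ι] {f : X → X} {Z : Set X}
    {t r : ℝ} {T : ℕ} (hT : 1 ≤ T) (hcard : Real.exp (t * T) ≤ Fintype.card ι)
    (y : (ℕ → ι) → X) (hy : ∀ s, y s ∈ Z)
    (hsep : ∀ (s s' : ℕ → ι) (v : ℕ) (c : X), y s ∈ bowenBall f v c r → y s' ∈ bowenBall f v c r →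
      ∀ j, (j + 1) * T ≤ v → s j = s' j) :
    bowenCLim f Z t r ≠ 0 := by
  classical
  let _ : MeasurableSpace ι := ⊤
  have : MeasurableSingletonClass ι := ⟨fun _ => trivial⟩
  set ν : Measure ι := (PMF.uniformOfFintype ι).toMeasure with hν
  have : IsProbabilityMeasure ν := by rw [hν]; infer_instance
  set P : Measure (ℕ → ι) := Measure.infinitePi (fun _ => ν) with hP
  have hN : (0:ℝ) < Fintype.card ι := by exact_mod_cast Fintype.card_pos
  set C : ℝ := Real.exp (|t| * T) with hC
  have hT0 : (0:ℝ) < T := by exact_mod_cast hT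
  have hball : ∀ (v : ℕ) (c : X), P {s | y s ∈ bowenBall f v c r} ≤
      ENNReal.ofReal C * ENNReal.ofReal (Real.exp (-t * v)) := by
    intro v c
    by_cases hem : ∃ s₀, y s₀ ∈ bowenBall f v c r
    · obtain ⟨s₀, hs₀⟩ := hem
      have hsub : {s | y s ∈ bowenBall f v c r} ⊆
          Set.pi (Finset.range (v / T) : Finset ℕ) (fun j => {s₀ j}) := by
        intro s hs j hj
        have hj' : j < v / T := by simpa using hj
        refine hsep s s₀ v c hs hs₀ j ?_
        calc (j + 1) * T ≤ (v / T) * T := Nat.mul_le_mul_right _ hj'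
          _ ≤ v := Nat.div_mul_le_self v T
      refine (measure_mono hsub).trans ?_
      rw [hP, Measure.infinitePi_pi _ (fun i _ => measurableSet_singleton _)]
      have hsing : ∀ a : ι, ν {a} = ENNReal.ofReal ((Fintype.card ι : ℝ)⁻¹) := by
        intro a
        rw [hν, PMF.toMeasure_apply_singleton _ _ (measurableSet_singleton a),
          PMF.uniformOfFintype_apply, ENNReal.ofReal_inv_of_pos hN]
        simp
      simp only [hsing, Finset.prod_const, Finset.card_range]
      rw [← ENNReal.ofReal_pow (by positivity), ← ENNReal.ofReal_mul (Real.exp_pos _).le]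
      apply ENNReal.ofReal_le_ofReal
      have h1 : ((Fintype.card ι : ℝ)⁻¹) ≤ Real.exp (-(t * T)) := by
        rw [Real.exp_neg]
        exact inv_anti₀ (Real.exp_pos _) hcard
      calc ((Fintype.card ι : ℝ)⁻¹) ^ (v / T) ≤ (Real.exp (-(t * T))) ^ (v / T) :=
            pow_le_pow_left₀ (by positivity) h1 _
        _ = Real.exp ((v / T : ℕ) * (-(t * T))) := (Real.exp_nat_mul _ _).symm
        _ ≤ Real.exp (|t| * T + -t * v) := by
            apply Real.exp_le_exp.2
            have e1 : (v : ℝ) = T * (v / T : ℕ) + (v % T : ℕ) := by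
              exact_mod_cast (Nat.div_add_mod v T).symm
            have e2 : ((v % T : ℕ) : ℝ) ≤ T := by exact_mod_cast (Nat.mod_lt v hT).le
            have e3 : t * ((v % T : ℕ) : ℝ) ≤ |t| * T :=
              (mul_le_mul_of_nonneg_right (le_abs_self t) (by positivity)).trans
                (mul_le_mul_of_nonneg_left e2 (abs_nonneg t))
            rw [e1]
            linarith
        _ = C * Real.exp (-t * v) := by rw [Real.exp_add]
    · have : {s | y s ∈ bowenBall f v c r} = ∅ := by
        ext s; simp only [mem_ofPred_eq, mem_empty_iff_false, iff_false]
        exact fun h => hem ⟨s, h⟩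
      rw [this]; simp
  intro h0
  have h0' : bowenC f Z t r 0 = 0 := by
    have := le_iSup (fun n => bowenC f Z t r n) 0
    exact le_antisymm (this.trans h0.le) (zero_le)
  have hlow : (ENNReal.ofReal C)⁻¹ ≤ bowenC f Z t r 0 := by
    unfold bowenC
    refine le_iInf fun c => le_iInf fun v => le_iInf fun _ => le_iInf fun hcov => ?_
    have hCpos : 0 < ENNReal.ofReal C := ENNReal.ofReal_pos.2 (Real.exp_pos _)
    rw [ENNReal.inv_le_iff_le_mul (fun _ => hCpos.ne') (fun h => absurd h ENNReal.ofReal_ne_top),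
      ← ENNReal.tsum_mul_left]
    calc (1 : ℝ≥0∞) = P univ := measure_univ.symm
      _ ≤ P (⋃ i, {s | y s ∈ bowenBall f (v i) (c i) r}) := by
          apply measure_mono
          intro s _
          obtain ⟨i, hi⟩ := mem_iUnion.1 (hcov (hy s))
          exact mem_iUnion.2 ⟨i, hi⟩
      _ ≤ ∑' i, P {s | y s ∈ bowenBall f (v i) (c i) r} := measure_iUnion_le _
      _ ≤ _ := ENNReal.tsum_le_tsum fun i => hball _ _
  rw [h0'] at hlow
  simp at hlow

/-- Exponential growth of separated sets. -/
def SepGrowth (f : X → X) (Y : Set X) (t r : ℝ) : Prop :=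
  ∃ c : ℝ, 0 < c ∧ ∃ n₀ : ℕ, ∀ n ≥ n₀, ∃ F : Finset X, (∀ x ∈ F, x ∈ Y) ∧
    (∀ x ∈ F, ∀ x' ∈ F, x ≠ x' → ∃ i < n, r ≤ dist (f^[i] x) (f^[i] x')) ∧
    c * Real.exp (t * n) ≤ F.card

theorem sepGrowth_zero {f : X → X} {Y : Set X} {b : X} (hb : b ∈ Y) (r : ℝ) :
    SepGrowth f Y 0 r := by
  refine ⟨1, one_pos, 0, fun n _ => ⟨{b}, by simpa using hb, ?_, by simp⟩⟩
  intro x hx x' hx' hne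
  simp only [Finset.mem_singleton] at hx hx'
  exact absurd (hx.trans hx'.symm) hne

theorem sepGrowth_of_bowen {f : X → X} {Y : Set X} {b : X} (hb : b ∈ Y) {t r : ℝ} (ht : 0 < t) (hr : 0 < r)
    (h : bowenCLim f Y t r ≠ 0) : SepGrowth f Y t r := by
  classical
  have : ∃ n₀, bowenC f Y t r n₀ ≠ 0 := by
    by_contra hcon
    push Not at hcon
    exact h (by simp [bowenCLim, hcon])
  obtain ⟨n₀, hn₀⟩ := this
  obtain ⟨c, hc0, hc⟩ : ∃ c : ℝ, 0 < c ∧ ENNReal.ofReal c ≤ bowenC f Y t r n₀ := by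
    obtain ⟨c, hc, hc'⟩ := ENNReal.lt_iff_exists_nnreal_btwn.1 (pos_iff_ne_zero.2 hn₀)
    exact ⟨c, by exact_mod_cast hc, by simpa using hc'.le⟩
  set q : ℝ := Real.exp (-t) with hq
  have hq0 : 0 < q := Real.exp_pos _
  have hq1 : q < 1 := by rw [hq]; exact (Real.exp_lt_exp.2 (by linarith : -t < 0)).trans_eq Real.exp_zero
  set D : ℝ := (1 - q)⁻¹ with hD
  have hD0 : 0 < D := inv_pos.2 (by linarith)
  -- spanning sets are large
  have hspan : ∀ n ≥ n₀, ∀ F : Finset X, (Y ⊆ ⋃ x ∈ F, bowenBall f n x r) →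
      c * Real.exp (t * n) ≤ F.card + D := by
    intro n hn F hF
    set e := F.equivFin with he
    have hcov : Y ⊆ ⋃ i, bowenBall f (n + if i < F.card then 0 else i)
        ((fun i => if h : i < F.card then (e.symm ⟨i, h⟩ : X) else b) i) r := by
      intro y hy
      obtain ⟨x, hx, hyx⟩ := mem_iUnion₂.1 (hF hy)
      refine mem_iUnion.2 ⟨e ⟨x, hx⟩, ?_⟩
      simpa using hyx
    have h1 : bowenC f Y t r n₀ ≤ ∑' i : ℕ, ENNReal.ofReal (Real.exp (-t *
        ((n + if i < F.card then 0 else i : ℕ) : ℝ))) := by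
      unfold bowenC
      exact iInf_le_of_le _ (iInf_le_of_le (fun i => n + if i < F.card then 0 else i)
        (iInf_le_of_le (fun i => hn.trans (Nat.le_add_right _ _)) (iInf_le_of_le hcov le_rfl)))
    have hterm : ∀ i : ℕ, Real.exp (-t * ((n + if i < F.card then 0 else i : ℕ) : ℝ)) ≤
        Real.exp (-t * n) * ((if i < F.card then 1 else 0) + q ^ i) := by
      intro i
      have e1 : Real.exp (-t * ((n + i : ℕ) : ℝ)) = Real.exp (-t * n) * q ^ i := by
        rw [hq, ← Real.exp_nat_mul, ← Real.exp_add]; push_cast; ring_nf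
      split_ifs with hi
      · have : 0 < q ^ i := by positivity
        have h2 : 0 < Real.exp (-t * n) := Real.exp_pos _
        simp only [add_zero]
        nlinarith
      · rw [e1]; simp
    have hsum : HasSum (fun i : ℕ => Real.exp (-t * n) * ((if i < F.card then (1:ℝ) else 0) + q ^ i))
        (Real.exp (-t * n) * (F.card + D)) := by
      apply HasSum.mul_left
      apply HasSum.add
      · have : HasSum (fun i : ℕ => if i < F.card then (1:ℝ) else 0)
            (∑ i ∈ Finset.range F.card, (if i < F.card then (1:ℝ) else 0)) :=
          hasSum_sum_of_ne_finset_zero (f := fun i : ℕ => if i < F.card then (1:ℝ) else 0)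
          (s := Finset.range F.card) (by intro i hi; simpa using hi)
        have e2 : ∑ i ∈ Finset.range F.card, (if i < F.card then (1:ℝ) else 0) = F.card := by
          rw [Finset.sum_congr rfl (g := fun _ => (1:ℝ))
            (fun i hi => by simp [Finset.mem_range.1 hi])]
          simp
        rwa [e2] at this
      · exact hasSum_geometric_of_lt_one hq0.le hq1
    have h2 : ENNReal.ofReal c ≤ ENNReal.ofReal (Real.exp (-t * n) * (F.card + D)) := by
      refine (hc.trans h1).trans ?_
      rw [← hsum.tsum_eq, ENNReal.ofReal_tsum_of_nonneg _ hsum.summable]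
      · exact ENNReal.tsum_le_tsum fun i => ENNReal.ofReal_le_ofReal (hterm i)
      · intro i; positivity
    rw [ENNReal.ofReal_le_ofReal_iff (by positivity)] at h2
    calc c * Real.exp (t * n) ≤ Real.exp (-t * n) * (F.card + D) * Real.exp (t * n) :=
          mul_le_mul_of_nonneg_right h2 (Real.exp_pos _).le
      _ = (Real.exp (-t * n) * Real.exp (t * n)) * (F.card + D) := by ring
      _ = F.card + D := by rw [← Real.exp_add]; simp
  refine ⟨c / (1 + D), by positivity, n₀, fun n hn => ?_⟩
  have greedy : ∀ K : ℕ, ∃ F : Finset X, (∀ x ∈ F, x ∈ Y) ∧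
      (∀ x ∈ F, ∀ x' ∈ F, x ≠ x' → ∃ i < n, r ≤ dist (f^[i] x) (f^[i] x')) ∧
      1 ≤ F.card ∧ (K ≤ F.card ∨ Y ⊆ ⋃ x ∈ F, bowenBall f n x r) := by
    intro K
    induction K with
    | zero =>
      refine ⟨{b}, by simpa using hb, ?_, by simp, Or.inl (by simp)⟩
      intro x hx x' hx' hne
      simp only [Finset.mem_singleton] at hx hx'
      exact absurd (hx.trans hx'.symm) hne
    | succ K ih =>
      obtain ⟨F, hFY, hFs, hF1, hK | hsp⟩ := ih
      · by_cases hsp : Y ⊆ ⋃ x ∈ F, bowenBall f n x r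
        · exact ⟨F, hFY, hFs, hF1, Or.inr hsp⟩
        · obtain ⟨y, hy, hyF⟩ := not_subset.1 hsp
          have hy' : ∀ x ∈ F, ∃ i < n, r ≤ dist (f^[i] x) (f^[i] y) := by
            intro x hx
            by_contra hcon
            push Not at hcon
            exact hyF (mem_iUnion₂.2 ⟨x, hx, hcon⟩)
          by_cases hyF' : y ∈ F
          · obtain ⟨i, hi, hri⟩ := hy' y hyF'
            rw [dist_self] at hri
            linarith
          · refine ⟨insert y F, ?_, ?_, ?_, Or.inl ?_⟩
            · intro x hx
              rcases Finset.mem_insert.1 hx with rfl | hx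
              · exact hy
              · exact hFY x hx
            · intro x hx x' hx' hne
              rcases Finset.mem_insert.1 hx with rfl | hx₁ <;>
                rcases Finset.mem_insert.1 hx' with rfl | hx₂
              · exact absurd rfl hne
              · obtain ⟨i, hi, h⟩ := hy' x' hx₂
                exact ⟨i, hi, by rwa [dist_comm]⟩
              · exact hy' x hx₁
              · exact hFs x hx₁ x' hx₂ hne
            · rw [Finset.card_insert_of_notMem hyF']; omega
            · rw [Finset.card_insert_of_notMem hyF']; omega
      · exact ⟨F, hFY, hFs, hF1, Or.inr hsp⟩
  obtain ⟨K, hK⟩ := exists_nat_ge (c / (1 + D) * Real.exp (t * n))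
  obtain ⟨F, hFY, hFs, hF1, hF | hF⟩ := greedy K
  · exact ⟨F, hFY, hFs, hK.trans (by exact_mod_cast hF)⟩
  · refine ⟨F, hFY, hFs, ?_⟩
    have h1 := hspan n hn F hF
    have h2 : (1:ℝ) ≤ F.card := by exact_mod_cast hF1
    rw [div_mul_eq_mul_div, div_le_iff₀ (by positivity)]
    nlinarith

set_option maxHeartbeats 1000000 in
/-- The two families of loops. -/
theorem exists_family [CompactSpace X] {f : X → X} {Y : Set X} {Φ : X → ℝ} (hf : Continuous f)
    {b : X} (hb : Good f b b) (hY : ∀ x ∈ Y, Good f b x) {M : ℝ} (hM : ∀ x, |Φ x| ≤ M)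
    {α₁ α₂ : ℝ} (hα : α₂ < α₁)
    (h₁ : ∀ k : ℕ, ∃ x, Good f b x ∧ k * α₁ ≤ ∑ i ∈ Finset.range k, Φ (f^[i] x))
    (h₂ : ∀ k : ℕ, ∃ x, Good f b x ∧ ∑ i ∈ Finset.range k, Φ (f^[i] x) ≤ k * α₂)
    {t t' r : ℝ} (htt : t < t') (hg : SepGrowth f Y t' r) :
    ∃ η : ℝ, 0 < η ∧ ∀ δ : ℝ, 0 < δ → ∃ T : ℕ, 1 ≤ T ∧ ∃ (F : Finset X) (W : Bool → X → ℕ → X)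
      (B₁ B₂ : ℝ), F.Nonempty ∧ (∀ c, ∀ x ∈ F, IsPath f δ T b b (W c x)) ∧
      (∀ c, ∀ x ∈ F, ∀ x' ∈ F, x ≠ x' → ∃ i < T, r ≤ dist (W c x i) (W c x' i)) ∧
      (∀ x ∈ F, B₁ ≤ ∑ i ∈ Finset.range T, Φ (W true x i)) ∧
      (∀ x ∈ F, ∑ i ∈ Finset.range T, Φ (W false x i) ≤ B₂) ∧
      B₂ + 2 * η * T < B₁ ∧ Real.exp (t * T) ≤ F.card := by
  classical
  obtain ⟨c, hc, n₀, hgrow⟩ := hg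
  have hM0 : 0 ≤ M := (abs_nonneg _).trans (hM b)
  set g := α₁ - α₂ with hgdef
  have hg0 : 0 < g := by rw [hgdef]; linarith
  obtain ⟨q, hq⟩ := exists_nat_gt (max 1 (t / (t' - t)))
  have hq1 : 1 ≤ q := by
    have : (1:ℝ) < q := (le_max_left _ _).trans_lt hq
    exact_mod_cast this.le
  have hκ : 0 < q * (t' - t) - t := by
    have : t / (t' - t) < q := (le_max_right _ _).trans_lt hq
    rw [div_lt_iff₀ (by linarith)] at this
    linarith
  set κ := q * (t' - t) - t with hκdef
  set η := g / (12 * (q + 2)) with hη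
  have hη0 : 0 < η := by positivity
  have hηq : 3 * η * (q + 2) = g / 4 := by rw [hη]; field_simp; ring
  refine ⟨η, hη0, fun δ hδ => ?_⟩
  obtain ⟨L, hL⟩ := good_uniform hf b hδ
  obtain ⟨l₁, hl₁, w₁, hw₁, hs₁⟩ := exists_marker hf hb hM hδ (by positivity : 0 < g / 4) h₁
  obtain ⟨l₂, hl₂, w₂, hw₂, hs₂⟩ := exists_marker (Φ := fun x => -Φ x) hf hb
    (by simpa using hM) hδ (by positivity : 0 < g / 4) (α := -α₂) (by
      intro k
      obtain ⟨x, hx, hx'⟩ := h₂ k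
      refine ⟨x, hx, ?_⟩
      rw [Finset.sum_neg_distrib]
      linarith)
  rw [Finset.sum_neg_distrib] at hs₂
  set B := ⌊2 * M / η⌋₊ with hB
  set D : ℕ := (L + 1) * ((L + 1) * (B + 1)) with hD
  have hD0 : (0:ℝ) < D := by rw [hD]; positivity
  obtain ⟨R, hR⟩ := exists_nat_gt (max (n₀ : ℝ) (max (2 * L) (max 1
    ((Real.log D + 2 * L * |t| - Real.log c) / κ))))
  simp only [max_lt_iff] at hR
  obtain ⟨hR1, hR2, hR3, hR4⟩ := hR
  rw [div_lt_iff₀ hκ] at hR4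
  set Q := R * (l₁ * l₂) with hQ
  have hRQ : R ≤ Q := Nat.le_mul_of_pos_right _ (Nat.mul_pos hl₁ hl₂)
  have hRQ' : (R : ℝ) ≤ Q := by exact_mod_cast hRQ
  have hQ1 : (1:ℝ) < Q := hR3.trans_le hRQ'
  set n := q * Q with hn
  have hQn : Q ≤ n := Nat.le_mul_of_pos_left _ hq1
  have hn0 : n₀ ≤ n := by
    have : n₀ < R := by exact_mod_cast hR1
    omega
  have hn1 : 1 ≤ n := by
    have : 1 < Q := by exact_mod_cast hQ1
    omega
  obtain ⟨Λ₁, hΛ₁, hΛs₁⟩ := hw₁.rep Φ (R * l₂)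
  obtain ⟨Λ₂, hΛ₂, hΛs₂⟩ := hw₂.rep Φ (R * l₁)
  have e₁ : R * l₂ * l₁ = Q := by rw [hQ]; ring
  have e₂ : R * l₁ * l₂ = Q := by rw [hQ]; ring
  rw [e₁] at hΛ₁ hΛs₁
  rw [e₂] at hΛ₂ hΛs₂
  have hQr : (Q : ℝ) = R * l₁ * l₂ := by rw [hQ]; push_cast; ring
  have hΛ₁' : Q * (α₁ - g / 4) ≤ ∑ i ∈ Finset.range Q, Φ (Λ₁ i) := by
    rw [hΛs₁, hQr]; push_cast
    have := mul_le_mul_of_nonneg_left hs₁ (by positivity : (0:ℝ) ≤ R * l₂)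
    linarith
  have hΛ₂' : ∑ i ∈ Finset.range Q, Φ (Λ₂ i) ≤ Q * (α₂ + g / 4) := by
    rw [hΛs₂, hQr]; push_cast
    have := mul_le_mul_of_nonneg_left hs₂ (by positivity : (0:ℝ) ≤ R * l₁)
    linarith
  obtain ⟨F₀, hF₀Y, hF₀s, hF₀c⟩ := hgrow n hn0
  have hp : ∀ x, ∃ (a : ℕ) (w : ℕ → X), x ∈ Y → a ≤ L ∧ IsPath f δ a b x w := by
    intro x
    by_cases hx : x ∈ Y
    · obtain ⟨a, ha, w, hw⟩ := (hL x (hY x hx)).1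
      exact ⟨a, w, fun _ => ⟨ha, hw⟩⟩
    · exact ⟨0, fun _ => b, fun h => absurd h hx⟩
  have hp' : ∀ x, ∃ (a : ℕ) (w : ℕ → X), x ∈ Y → a ≤ L ∧ IsPath f δ a (f^[n] x) b w := by
    intro x
    by_cases hx : x ∈ Y
    · obtain ⟨a, ha, w, hw⟩ := (hL _ (Good.iter hf hb (hY x hx) n)).2
      exact ⟨a, w, fun _ => ⟨ha, hw⟩⟩
    · exact ⟨0, fun _ => b, fun h => absurd h hx⟩
  choose p₁ v₁ hv₁ using hp
  choose p₂ v₂ hv₂ using hp'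
  set loop : X → ℕ → X := fun x => pcat (p₁ x) (v₁ x) (pcat n (fun i => f^[i] x) (v₂ x)) with hloop
  set m : X → ℕ := fun x => p₁ x + (n + p₂ x) with hm
  have hlp : ∀ x ∈ Y, IsPath f δ (m x) b b (loop x) := fun x hx =>
    (hv₁ x hx).2.cat ((isPath_orbit f hδ n x).cat (hv₂ x hx).2)
  set V : X → ℝ := fun x => ∑ i ∈ Finset.range (m x), Φ (loop x i) with hV
  have hm0 : ∀ x, (0:ℝ) < m x := by
    intro x
    have : 0 < m x := by simp only [hm]; omega
    exact_mod_cast this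
  have hVabs : ∀ x, |V x| ≤ m x * M := by
    intro x
    calc |V x| ≤ ∑ i ∈ Finset.range (m x), |Φ (loop x i)| := Finset.abs_sum_le_sum_abs _ _
      _ ≤ ∑ i ∈ Finset.range (m x), M := Finset.sum_le_sum fun i _ => hM _
      _ = m x * M := by simp
  have hVM : ∀ x, 0 ≤ V x / m x + M ∧ V x / m x + M ≤ 2 * M := by
    intro x
    have h := abs_le.1 (hVabs x)
    have h3 : -M ≤ V x / m x := by rw [le_div_iff₀ (hm0 x)]; linarith
    have h4 : V x / m x ≤ M := by rw [div_le_iff₀ (hm0 x)]; linarith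
    constructor <;> linarith
  set bin : X → ℕ := fun x => ⌊(V x / m x + M) / η⌋₊ with hbin
  set key : X → ℕ × ℕ × ℕ := fun x => (p₁ x, p₂ x, bin x) with hkey
  set E : ℝ := t * ((q + 1) * Q) + 2 * L * |t| with hE
  have hmaps : ∀ x ∈ F₀, key x ∈ Finset.range (L + 1) ×ˢ Finset.range (L + 1) ×ˢ
      Finset.range (B + 1) := by
    intro x hx
    have hx' := hF₀Y x hx
    simp only [hkey, Finset.mem_product, Finset.mem_range]
    refine ⟨Nat.lt_succ_of_le (hv₁ x hx').1, Nat.lt_succ_of_le (hv₂ x hx').1, Nat.lt_succ_of_le ?_⟩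
    exact Nat.floor_le_floor (div_le_div_of_nonneg_right (hVM x).2 hη0.le)
  have hcount : (Finset.range (L + 1) ×ˢ Finset.range (L + 1) ×ˢ Finset.range (B + 1)).card *
      ⌊Real.exp E⌋₊ < F₀.card := by
    have h3 : (D : ℝ) * Real.exp E < c * Real.exp (t' * n) := by
      rw [← Real.exp_log hD0, ← Real.exp_log hc, ← Real.exp_add, ← Real.exp_add]
      apply Real.exp_lt_exp.2
      have h5 : R * κ ≤ Q * κ := mul_le_mul_of_nonneg_right hRQ' hκ.le
      have h6 : t' * (n : ℝ) - t * ((q + 1) * Q) = Q * κ := by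
        rw [hn, hκdef]; push_cast; ring
      rw [hE]
      linarith
    have h4 : (⌊Real.exp E⌋₊ : ℝ) ≤ Real.exp E := Nat.floor_le (Real.exp_pos _).le
    have h5 : (D : ℝ) * ⌊Real.exp E⌋₊ < F₀.card :=
      ((mul_le_mul_of_nonneg_left h4 hD0.le).trans_lt h3).trans_le hF₀c
    have h6 : D * ⌊Real.exp E⌋₊ < F₀.card := by exact_mod_cast h5
    simpa [hD] using h6
  obtain ⟨⟨a₁, a₂, β⟩, hmem, hfib⟩ :=
    Finset.exists_lt_card_fiber_of_mul_lt_card_of_maps_to hmaps hcount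
  simp only [Finset.mem_product, Finset.mem_range] at hmem
  set F := F₀.filter (fun x => key x = (a₁, a₂, β)) with hF
  have hFmem : ∀ x ∈ F, x ∈ F₀ ∧ x ∈ Y ∧ p₁ x = a₁ ∧ p₂ x = a₂ ∧ bin x = β := by
    intro x hx
    rw [hF, Finset.mem_filter] at hx
    have hk := hx.2
    simp only [hkey, Prod.mk.injEq] at hk
    exact ⟨hx.1, hF₀Y x hx.1, hk⟩
  set m₀ := a₁ + (n + a₂) with hm₀
  have hmx : ∀ x ∈ F, m x = m₀ := by
    intro x hx
    obtain ⟨-, -, h3, h4, -⟩ := hFmem x hx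
    simp only [hm, hm₀, h3, h4]
  have hm₀0 : (0:ℝ) < m₀ := by
    have : 0 < m₀ := by omega
    exact_mod_cast this
  have hVx : ∀ x ∈ F, m₀ * (β * η - M) ≤ V x ∧ V x ≤ m₀ * ((β + 1) * η - M) := by
    intro x hx
    obtain ⟨-, -, -, -, h5⟩ := hFmem x hx
    have h6 : (β : ℝ) ≤ (V x / m x + M) / η := by
      rw [← h5]; exact Nat.floor_le (div_nonneg (hVM x).1 hη0.le)
    have h7 : (V x / m x + M) / η < β + 1 := by
      rw [← h5]; exact Nat.lt_floor_add_one _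
    rw [hmx x hx] at h6 h7
    rw [le_div_iff₀ hη0] at h6
    rw [div_lt_iff₀ hη0] at h7
    have h8 : β * η - M ≤ V x / m₀ := by linarith
    have h9 : V x / m₀ ≤ (β + 1) * η - M := by linarith
    rw [le_div_iff₀ hm₀0] at h8
    rw [div_le_iff₀ hm₀0] at h9
    constructor <;> linarith
  have ha₁ : (a₁ : ℝ) ≤ L := by exact_mod_cast Nat.le_of_lt_succ hmem.1
  have ha₂ : (a₂ : ℝ) ≤ L := by exact_mod_cast Nat.le_of_lt_succ hmem.2.1
  have hm₀r : (m₀ : ℝ) = a₁ + (q * Q + a₂) := by rw [hm₀, hn]; push_cast; ring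
  refine ⟨m₀ + Q, by omega, F, fun cc x => pcat m₀ (loop x) (if cc then Λ₁ else Λ₂),
    m₀ * (β * η - M) + Q * (α₁ - g / 4), m₀ * ((β + 1) * η - M) + Q * (α₂ + g / 4), ?_, ?_, ?_, ?_,
    ?_, ?_, ?_⟩
  · exact Finset.card_pos.1 (lt_of_le_of_lt (Nat.zero_le _) hfib)
  · intro cc x hx
    have h3 := hlp x (hFmem x hx).2.1
    rw [hmx x hx] at h3
    cases cc
    · simpa using h3.cat hΛ₂
    · simpa using h3.cat hΛ₁
  · intro cc x hx x' hx' hne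
    obtain ⟨i, hi, hri⟩ := hF₀s x (hFmem x hx).1 x' (hFmem x' hx').1 hne
    have hval : ∀ z ∈ F, pcat m₀ (loop z) (if cc then Λ₁ else Λ₂) (a₁ + i) = f^[i] z := by
      intro z hz
      have h3 : a₁ + i < m₀ := by omega
      simp [pcat, h3, hloop, (hFmem z hz).2.2.1, hi]
    refine ⟨a₁ + i, by omega, ?_⟩
    simp only [hval x hx, hval x' hx']
    exact hri
  · intro x hx
    simp only [if_true]
    rw [pcat_sum]
    have h3 := (hVx x hx).1
    simp only [hV, hmx x hx] at h3
    linarith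
  · intro x hx
    simp only [Bool.false_eq_true, if_false]
    rw [pcat_sum]
    have h3 := (hVx x hx).2
    simp only [hV, hmx x hx] at h3
    linarith
  · have h3 : (m₀ : ℝ) ≤ (q + 1) * Q := by rw [hm₀r]; linarith
    have h4 : 3 * η * m₀ ≤ 3 * η * ((q + 1) * Q) := mul_le_mul_of_nonneg_left h3 (by positivity)
    have h5 : 3 * η * ((q + 1) * Q) + 3 * η * Q = g / 4 * Q := by rw [← hηq]; ring
    have h6 : 0 < g * Q := by positivity
    have h7 : 0 < η * Q := by positivity
    have h8 : α₁ = g + α₂ := by rw [hgdef]; ring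
    push_cast
    rw [h8]
    linarith
  · have h3 : Real.exp E < (⌊Real.exp E⌋₊ : ℝ) + 1 := Nat.lt_floor_add_one _
    have h4 : ((⌊Real.exp E⌋₊ : ℝ) + 1) ≤ F.card := by exact_mod_cast hfib
    refine le_trans ?_ (h3.le.trans h4)
    apply Real.exp_le_exp.2
    push_cast
    rw [hm₀r, hE]
    have h5 : t * (a₁ + a₂) ≤ |t| * (a₁ + a₂) :=
      mul_le_mul_of_nonneg_right (le_abs_self t) (by positivity)
    have h6 : |t| * (a₁ + a₂) ≤ |t| * (2 * L) :=
      mul_le_mul_of_nonneg_left (by linarith) (abs_nonneg t)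
    linarith

theorem core [CompactSpace X] {f : X → X} {Y : Set X} {Φ : X → ℝ} (hf : Continuous f)
    (hsh : ShadowingProperty f) (hΦ : Continuous Φ)
    {b : X} (hbY : b ∈ Y) (hY : ∀ x ∈ Y, Good f b x)
    {α₁ α₂ : ℝ} (hα : α₂ < α₁)
    (h₁ : ∀ k : ℕ, ∃ x ∈ Y, k * α₁ ≤ ∑ i ∈ Finset.range k, Φ (f^[i] x))
    (h₂ : ∀ k : ℕ, ∃ x ∈ Y, ∑ i ∈ Finset.range k, Φ (f^[i] x) ≤ k * α₂)
    {t t' r ε : ℝ} (htt : t < t') (hr : 0 < r) (hε : 0 < ε) (hg : SepGrowth f Y t' r) :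
    (IrregularSet f Φ ∩ Metric.thickening ε Y ∩ ChainRecurrent f).Nonempty ∧
    ∃ r' > 0, ∀ t'' ≤ t,
      bowenCLim f (IrregularSet f Φ ∩ Metric.thickening ε Y ∩ ChainRecurrent f) t'' r' ≠ 0 := by
  classical
  obtain ⟨M, hM⟩ := isCompact_univ.exists_bound_of_continuousOn hΦ.continuousOn
  obtain ⟨η, hη, hfam⟩ := exists_family hf (hY b hbY) hY (M := M)
    (fun x => by simpa using hM x (mem_univ x)) hα
    (fun k => by obtain ⟨x, hx, h⟩ := h₁ k; exact ⟨x, hY x hx, h⟩)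
    (fun k => by obtain ⟨x, hx, h⟩ := h₂ k; exact ⟨x, hY x hx, h⟩) htt hg
  obtain ⟨ρ, hρ, hρ'⟩ := Metric.uniformContinuous_iff.1
    (CompactSpace.uniformContinuous_of_continuous hΦ) η hη
  set ε' := min (min (r / 4) (ε / 2)) (ρ / 2) with hε'
  have hε'0 : 0 < ε' := by rw [hε']; positivity
  have hε'1 : ε' ≤ r / 4 := (min_le_left _ _).trans (min_le_left _ _)
  have hε'2 : ε' ≤ ε / 2 := (min_le_left _ _).trans (min_le_right _ _)
  have hε'3 : ε' ≤ ρ / 2 := min_le_right _ _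
  obtain ⟨δ, hδ, hshad⟩ := hsh ε' hε'0
  obtain ⟨T, hT, F, W, B₁, B₂, hFne, hWp, hWs, hWt, hWf, hB, hcard⟩ := hfam δ hδ
  have : Nonempty F := hFne.to_subtype
  set W' : Bool × F → ℕ → X := fun a => W a.1 a.2 with hW'
  have hW'p : ∀ a, IsPath f δ T b b (W' a) := fun a => hWp _ _ a.2.2
  set col : ℕ → Bool := fun j => decide (Nat.log 2 j % 2 = 0) with hcol
  have hex : ∀ s : ℕ → F, ∃ y ∈ ChainRecurrent f,
      ∀ i, dist (f^[i] y) (conc T W' (fun j => (col j, s j)) i) ≤ ε' := fun s =>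
    exists_cr_shadow hf hshad hT hW'p _
  choose y hycr hy using hex
  have hconc : ∀ (s : ℕ → F) (j i : ℕ), i < T →
      conc T W' (fun j => (col j, s j)) (j * T + i) = W (col j) (s j) i := by
    intro s j i hi
    have e1 : (j * T + i) / T = j := by
      rw [add_comm, Nat.add_mul_div_right _ _ hT, Nat.div_eq_of_lt hi, zero_add]
    have e2 : (j * T + i) % T = i := by
      rw [add_comm, Nat.add_mul_mod_self_right, Nat.mod_eq_of_lt hi]
    simp only [conc, e1, e2, hW']
  have hclose : ∀ (s : ℕ → F) (j i : ℕ), i < T →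
      |Φ (f^[j * T + i] (y s)) - Φ (W (col j) (s j) i)| ≤ η := by
    intro s j i hi
    have h3 := hy s (j * T + i)
    rw [hconc s j i hi] at h3
    have h4 := hρ' (lt_of_le_of_lt h3 (by linarith))
    rw [Real.dist_eq] at h4
    exact h4.le
  have hmem : ∀ s, y s ∈ IrregularSet f Φ ∩ Metric.thickening ε Y ∩ ChainRecurrent f := by
    intro s
    refine ⟨⟨?_, ?_⟩, hycr s⟩
    · refine irregular_of_blocks hT (B₁ := B₁ - η * T) (B₂ := B₂ + η * T) (by linarith) ?_ ?_
      · intro j hj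
        have hc : col j = true := by simp [hcol, hj]
        have h3 := hWt (s j) (s j).2
        have h4 : ∑ i ∈ Finset.range T, (Φ (W true (s j) i) - η) ≤
            ∑ i ∈ Finset.range T, Φ (f^[j * T + i] (y s)) := by
          refine Finset.sum_le_sum fun i hi => ?_
          have h5 := abs_le.1 (hclose s j i (Finset.mem_range.1 hi))
          rw [hc] at h5
          linarith
        rw [Finset.sum_sub_distrib] at h4
        simp only [Finset.sum_const, Finset.card_range, nsmul_eq_mul] at h4
        linarith
      · intro j hj
        have hc : col j = false := by simp [hcol, hj]
        have h3 := hWf (s j) (s j).2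
        have h4 : ∑ i ∈ Finset.range T, Φ (f^[j * T + i] (y s)) ≤
            ∑ i ∈ Finset.range T, (Φ (W false (s j) i) + η) := by
          refine Finset.sum_le_sum fun i hi => ?_
          have h5 := abs_le.1 (hclose s j i (Finset.mem_range.1 hi))
          rw [hc] at h5
          linarith
        rw [Finset.sum_add_distrib] at h4
        simp only [Finset.sum_const, Finset.card_range, nsmul_eq_mul] at h4
        linarith
    · rw [Metric.mem_thickening_iff]
      refine ⟨b, hbY, ?_⟩
      have h3 := hy s (0 * T + 0)
      rw [hconc s 0 0 (by omega), (hWp _ _ (s 0).2).1] at h3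
      simp only [zero_mul, add_zero, Function.iterate_zero, id] at h3
      linarith
  refine ⟨⟨_, hmem (Classical.arbitrary _)⟩, r / 4, by positivity, fun t'' ht'' => ?_⟩
  refine bowenCLim_ne_zero_of_coding (ι := F) hT ?_ y hmem ?_
  · rw [Fintype.card_coe]
    refine le_trans (Real.exp_le_exp.2 ?_) hcard
    exact mul_le_mul_of_nonneg_right ht'' (by positivity)
  · intro s s' v c hs hs' j hj
    by_contra hne
    obtain ⟨i, hi, hri⟩ := hWs (col j) (s j) (s j).2 (s' j) (s' j).2
      (fun h => hne (Subtype.ext h))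
    have hlt : j * T + i < v := by rw [Nat.add_mul] at hj; omega
    have d1 := hs _ hlt
    have d2 := hs' _ hlt
    have d3 := hy s (j * T + i)
    have d4 := hy s' (j * T + i)
    rw [hconc _ _ _ hi] at d3 d4
    have d5 := dist_triangle4 (W (col j) (s j) i) (f^[j * T + i] (y s)) (f^[j * T + i] c)
      (W (col j) (s' j) i)
    have d6 := dist_triangle (f^[j * T + i] c) (f^[j * T + i] (y s')) (W (col j) (s' j) i)
    rw [dist_comm] at d3
    rw [dist_comm (f^[j * T + i] c) (f^[j * T + i] (y s))] at d1
    linarith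

theorem core_final [CompactSpace X] {f : X → X} {Y : Set X} {Φ : X → ℝ} (hf : Continuous f)
    (hsh : ShadowingProperty f) (hΦ : Continuous Φ)
    {b : X} (hbY : b ∈ Y) (hY : ∀ x ∈ Y, Good f b x)
    {α₁ α₂ : ℝ} (hα : α₂ < α₁)
    (h₁ : ∀ k : ℕ, ∃ x ∈ Y, k * α₁ ≤ ∑ i ∈ Finset.range k, Φ (f^[i] x))
    (h₂ : ∀ k : ℕ, ∃ x ∈ Y, ∑ i ∈ Finset.range k, Φ (f^[i] x) ≤ k * α₂)
    {ε : ℝ} (hε : 0 < ε) :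
    (IrregularSet f Φ ∩ Metric.thickening ε Y ∩ ChainRecurrent f).Nonempty ∧
    bowenEntropy f Y ≤
      bowenEntropy f (IrregularSet f Φ ∩ Metric.thickening ε Y ∩ ChainRecurrent f) := by
  refine ⟨(core hf hsh hΦ hbY hY hα h₁ h₂ (t := -1) (t' := 0) (r := 1) (by norm_num) one_pos hε
    (sepGrowth_zero hbY 1)).1, ?_⟩
  set S := IrregularSet f Φ ∩ Metric.thickening ε Y ∩ ChainRecurrent f with hS
  conv_lhs => unfold bowenEntropy
  refine iSup₂_le fun r hr => ?_
  by_contra hcon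
  push Not at hcon
  obtain ⟨a, ha1, ha2⟩ := ENNReal.lt_iff_exists_nnreal_btwn.1 hcon
  obtain ⟨a', ha1', ha2'⟩ := ENNReal.lt_iff_exists_nnreal_btwn.1 ha2
  have haa : (a : ℝ) < a' := by exact_mod_cast ha1'
  have hne : bowenCLim f Y a' r ≠ 0 := by
    intro h0
    have : bowenH f Y r ≤ ENNReal.ofReal a' := sInf_le ⟨_, h0, rfl⟩
    rw [ENNReal.ofReal_coe_nnreal] at this
    exact absurd ha2' (not_lt.2 this)
  have ha'0 : (0:ℝ) < a' := lt_of_le_of_lt a.2 haa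
  obtain ⟨-, r', hr', hcl⟩ := core hf hsh hΦ hbY hY hα h₁ h₂ haa hr hε
    (sepGrowth_of_bowen hbY ha'0 hr hne)
  have hle : bowenH f S r' ≤ bowenEntropy f S :=
    le_iSup₂_of_le (f := fun (ε : ℝ) (_ : 0 < ε) => bowenH f S ε) r' hr' le_rfl
  have hlt := hle.trans_lt ha1
  obtain ⟨_, ⟨t'', ht'', rfl⟩, hta⟩ := sInf_lt_iff.1 hlt
  refine hcl t'' ?_ ht''
  by_contra hcon2
  push Not at hcon2
  have : (a : ℝ≥0∞) ≤ ENNReal.ofReal t'' := by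
    rw [← ENNReal.ofReal_coe_nnreal]
    exact ENNReal.ofReal_le_ofReal hcon2.le
  exact absurd hta (not_lt.2 this)

/-- Main theorem (entropy version): under shadowing, the irregular set near a chain class
carrying two ergodic measures with distinct `Φ`-averages is nonempty and has Bowen entropy
at least that of the class. -/
theorem irregular_set_entropy_lower_bound [CompactSpace X]
    [MeasurableSpace X] [BorelSpace X]
    (f : X → X) (hf : Continuous f) (hsh : ShadowingProperty f)
    (Y : Set X) (hY : IsChainClass f Y)
    (Φ : X → ℝ) (hΦ : Continuous Φ)
    (μ₁ μ₂ : Measure X)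
    (h₁p : IsProbabilityMeasure μ₁) (h₂p : IsProbabilityMeasure μ₂)
    (h₁e : Ergodic f μ₁) (h₂e : Ergodic f μ₂)
    (h₁Y : μ₁ Y = 1) (h₂Y : μ₂ Y = 1)
    (hne : ∫ x, Φ x ∂μ₁ ≠ ∫ x, Φ x ∂μ₂)
    (ε : ℝ) (hε : 0 < ε) :
    (IrregularSet f Φ ∩ Metric.thickening ε Y ∩ ChainRecurrent f).Nonempty ∧
    bowenEntropy f Y ≤
      bowenEntropy f (IrregularSet f Φ ∩ Metric.thickening ε Y ∩ ChainRecurrent f) := by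
  obtain ⟨b, hbcr, rfl⟩ := hY
  have hbY : b ∈ ChainClassOf f b := ⟨hbcr, hbcr⟩
  have hgood : ∀ x ∈ ChainClassOf f b, Good f b x := fun x hx δ hδ =>
    ⟨(hx.2 δ hδ).2.exists_path hδ, (hx.2 δ hδ).1.exists_path hδ⟩
  have hup : ∀ (μ : Measure X), IsProbabilityMeasure μ → Ergodic f μ → μ (ChainClassOf f b) = 1 →
      ∀ k : ℕ, ∃ x ∈ ChainClassOf f b, k * ∫ x, Φ x ∂μ ≤ ∑ i ∈ Finset.range k, Φ (f^[i] x) :=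
    fun μ hp he hμ k => exists_large_sum hf hΦ μ hp he.toMeasurePreserving hμ k
  have hdn : ∀ (μ : Measure X), IsProbabilityMeasure μ → Ergodic f μ → μ (ChainClassOf f b) = 1 →
      ∀ k : ℕ, ∃ x ∈ ChainClassOf f b, ∑ i ∈ Finset.range k, Φ (f^[i] x) ≤ k * ∫ x, Φ x ∂μ := by
    intro μ hp he hμ k
    obtain ⟨x, hx, h⟩ := exists_large_sum (Φ := fun x => -Φ x) hf hΦ.neg μ hp he.toMeasurePreserving hμ k
    refine ⟨x, hx, ?_⟩
    simp only [integral_neg, Finset.sum_neg_distrib] at h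
    linarith
  rcases lt_or_gt_of_ne hne with h | h
  · exact core_final hf hsh hΦ hbY hgood h (hup μ₂ h₂p h₂e h₂Y) (hdn μ₁ h₁p h₁e h₁Y) hε
  · exact core_final hf hsh hΦ hbY hgood h (hup μ₁ h₁p h₁e h₁Y) (hdn μ₂ h₂p h₂e h₂Y) hε
end

section
/- Theorem (main, metric mean dimension version): Under the hypotheses that f has shadowing, Y ⊆ X is a chain recurrent class, and there exist ergodic measures μ_1, μ_2 supported in Y with ∫Φ dμ_1 ≠ ∫Φ dμ_2, for every ε > 0 the set S = I_Φ(f) ∩ B(Y,ε) ∩ CR(f) satisfies: the upper relative metric mean dimension of S is at least that of Y, and the lower relative metric mean dimension of S is at least that of Y. -/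
open Filter Topology MeasureTheory Set
open scoped ENNReal NNReal

variable {X : Type*} [MetricSpace X]

/-- `c` is a `δ`-pseudo-orbit for the first `n` steps. -/
def PC (f : X → X) (δ : ℝ) (n : ℕ) (c : ℕ → X) : Prop :=
  ∀ i < n, dist (f (c i)) (c (i + 1)) < δ

/-- Concatenation of two sequences at time `n`. -/
def app (n : ℕ) (c c' : ℕ → X) : ℕ → X := fun i => if i < n then c i else c' (i - n)

lemma app_add (n : ℕ) (c c' : ℕ → X) (i : ℕ) : app n c c' (n + i) = c' i := by
  simp [app]

lemma app_le (n : ℕ) (c c' : ℕ → X) (h : c n = c' 0) (i : ℕ) (hi : i ≤ n) :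
    app n c c' i = c i := by
  rcases hi.lt_or_eq with h1 | h1
  · simp [app, h1]
  · subst h1; simp [app, h]

lemma PC_append {f : X → X} {δ : ℝ} {n m : ℕ} {c c' : ℕ → X} (hc : PC f δ n c)
    (hc' : PC f δ m c') (h : c n = c' 0) : PC f δ (n + m) (app n c c') := by
  intro i hi
  by_cases h1 : i < n
  · rw [app_le n c c' h i h1.le, app_le n c c' h (i + 1) h1]
    exact hc i h1
  · obtain ⟨k, rfl⟩ := Nat.exists_eq_add_of_le (not_lt.1 h1)
    rw [add_assoc, app_add, app_add]
    exact hc' k (by omega)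

lemma chain_of_stable {f : X → X} {δ : ℝ} (hδ : 0 < δ) {x y : X} (h : ChainStable f δ x y) :
    ∃ n c, 1 ≤ n ∧ c 0 = x ∧ c n = y ∧ PC f δ n c := by
  obtain ⟨n, c, t, hn, h0, hcn, hc⟩ := h
  have key : ∀ m, 1 ≤ m → m ≤ n → ∃ n' c', 1 ≤ n' ∧ c' 0 = x ∧ c' n' = c m ∧ PC f δ n' c' := by
    intro m hm
    have seg : ∀ i < n, ∃ n' c', 1 ≤ n' ∧ c' 0 = c i ∧ c' n' = c (i+1) ∧ PC f δ n' c' := by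
      intro i hi
      obtain ⟨ht, hd⟩ := hc i hi
      refine ⟨t i, fun k => if k < t i then f^[k] (c i) else c (i+1), ht, ?_, ?_, ?_⟩
      · simp [show 0 < t i from ht]
      · simp
      · intro k hk
        by_cases h1 : k + 1 < t i
        · simp only [hk, h1, if_true, Function.iterate_succ_apply', dist_self]
          exact hδ
        · have : k + 1 = t i := by omega
          simp only [hk, h1, if_true, if_false]
          rw [← Function.iterate_succ_apply' f, Nat.succ_eq_add_one, this]
          exact hd
    induction m, hm using Nat.le_induction with
    | base =>
      intro h1
      obtain ⟨n', c', a, b, d, e⟩ := seg 0 (by omega)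
      exact ⟨n', c', a, by rw [b, h0], d, e⟩
    | succ m hm ih =>
      intro h1
      obtain ⟨n', c', a, b, d, e⟩ := ih (by omega)
      obtain ⟨n2, c2, a2, b2, d2, e2⟩ := seg m (by omega)
      have hj : c' n' = c2 0 := by rw [d, b2]
      refine ⟨n' + n2, app n' c' c2, by omega, ?_, ?_, PC_append e e2 hj⟩
      · rw [app_le _ _ _ hj 0 (by omega), b]
      · rw [app_add, d2]
  obtain ⟨n', c', a, b, d, e⟩ := key n hn le_rfl
  exact ⟨n', c', a, b, by rw [d, hcn], e⟩

lemma stable_of_chain {f : X → X} {δ : ℝ} {x y : X} {n : ℕ} {c : ℕ → X}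
    (hn : 1 ≤ n) (h0 : c 0 = x) (hcn : c n = y) (hc : PC f δ n c) : ChainStable f δ x y :=
  ⟨n, c, fun _ => 1, hn, h0, hcn, fun i hi => ⟨le_rfl, by simpa using hc i hi⟩⟩

lemma perturb [CompactSpace X] {f : X → X} (hf : Continuous f) {δ : ℝ} (hδ : 0 < δ) :
    ∃ δ0 > 0, ∀ (n : ℕ) (c c' : ℕ → X), PC f δ0 n c → (∀ i, dist (c' i) (c i) < δ0) →
      PC f δ n c' := by
  have huc := CompactSpace.uniformContinuous_of_continuous hf
  obtain ⟨a, ha, hau⟩ := Metric.uniformContinuous_iff.1 huc (δ / 3) (by positivity)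
  refine ⟨min a (δ / 3), by positivity, ?_⟩
  intro n c c' hc hd i hi
  have h1 := hau ((hd i).trans_le (min_le_left _ _))
  have h2 := (hc i hi).trans_le (min_le_right _ _)
  have h3 := (hd (i+1)).trans_le (min_le_right _ _)
  rw [dist_comm] at h3
  have := dist_triangle4 (f (c' i)) (f (c i)) (c (i+1)) (c' (i+1))
  linarith

lemma mem_CR_iff {f : X → X} {x : X} :
    x ∈ ChainRecurrent f ↔ ∀ δ > 0, ChainStable f δ x x :=
  ⟨fun h δ hδ => (h δ hδ).1, fun h δ hδ => ⟨h δ hδ, h δ hδ⟩⟩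

lemma isClosed_CR [CompactSpace X] {f : X → X} (hf : Continuous f) :
    IsClosed (ChainRecurrent f) := by
  refine isClosed_of_closure_subset fun y hy => mem_CR_iff.2 fun δ hδ => ?_
  obtain ⟨δ0, h0, hp⟩ := perturb hf hδ
  obtain ⟨y', hy', hd⟩ := Metric.mem_closure_iff.1 hy δ0 h0
  obtain ⟨n, c, hn, hc0, hcn, hc⟩ := chain_of_stable h0 (mem_CR_iff.1 hy' δ0 h0)
  refine stable_of_chain (c := fun i => if i = 0 ∨ i = n then y else c i) hn (by simp) (by simp)
    (hp n c _ hc fun i => ?_)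
  by_cases h : i = 0 ∨ i = n
  · simp only [h, if_true]
    rcases h with rfl | rfl
    · rwa [hc0]
    · rwa [hcn]
  · simp only [h, if_false, dist_self, h0]

lemma omega_CR {f : X → X} (hf : Continuous f) {x y : X} {n : ℕ} (hn : 1 ≤ n)
    (h : MapClusterPt y atTop (fun j : ℕ => f^[n * j] x)) : y ∈ ChainRecurrent f := by
  refine mem_CR_iff.2 fun δ hδ => ?_
  have h1 : ∀ᶠ w in 𝓝 y, dist (f y) (f w) < δ := by
    have := (hf.tendsto y).eventually (Metric.ball_mem_nhds (f y) hδ)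
    filter_upwards [this] with w hw
    rw [dist_comm]; exact hw
  obtain ⟨j1, hj1⟩ := (h.frequently h1).exists
  have h2 : ∀ᶠ w in 𝓝 y, dist w y < δ := Metric.ball_mem_nhds y hδ
  obtain ⟨j2, hj2, hj⟩ := ((h.frequently h2).and_eventually (eventually_ge_atTop (j1 + 2))).exists
  obtain ⟨k, rfl⟩ := Nat.exists_eq_add_of_le hj
  have hpos : 1 ≤ n * (k + 1) := Nat.mul_pos hn (by omega)
  refine ⟨2, fun i => if i = 1 then f^[n * j1 + 1] x else y,
    fun i => if i = 0 then 1 else n * (k + 2) - 1, by norm_num, by simp, by simp, ?_⟩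
  intro i hi
  interval_cases i
  · simp only [Function.iterate_succ_apply']
    simpa using hj1
  · have e : n * (k + 2) = n * (k + 1) + n := by ring
    refine ⟨by simp; omega, ?_⟩
    simp only [one_ne_zero, if_false, if_true]
    rw [← Function.iterate_add_apply]
    have : n * (k + 2) - 1 + (n * j1 + 1) = n * (j1 + 2 + k) := by
      have : n * (j1 + 2 + k) = n * (k + 2) + n * j1 := by ring
      omega
    rw [this]
    simpa using hj2

/-- Pseudo-orbits returning infinitely often to their start are shadowed by chain recurrent
points. -/
lemma CR_shadow [CompactSpace X] {f : X → X} (hf : Continuous f) {e δ : ℝ}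
    (hs : ∀ z : ℕ → X, (∀ n, dist (f (z n)) (z (n + 1)) < δ) →
      ∃ y : X, ∀ n, dist (f^[n] y) (z n) < e)
    (z : ℕ → X) (hz : ∀ n, dist (f (z n)) (z (n + 1)) < δ)
    (hret : ∀ m, ∃ n, m < n ∧ z n = z 0) :
    ∃ y ∈ ChainRecurrent f, ∀ n, dist (f^[n] y) (z n) ≤ e := by
  have step : ∀ m, ∃ y ∈ ChainRecurrent f, ∀ k ≤ m, dist (f^[k] y) (z k) ≤ e := by
    intro m
    obtain ⟨n, hmn, hn⟩ := hret m
    obtain ⟨x, hx⟩ := hs (fun k => z (k % n)) (by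
      intro k
      have hk : k % n < n := Nat.mod_lt _ (by omega)
      by_cases h1 : k % n + 1 < n
      · have : (k + 1) % n = k % n + 1 := by
          rw [← Nat.mod_add_mod, Nat.mod_eq_of_lt h1]
        simp only [this]; exact hz _
      · have h2 : k % n + 1 = n := by omega
        have : (k + 1) % n = 0 := by
          rw [← Nat.mod_add_mod, h2, Nat.mod_self]
        simp only [this]
        have := hz (k % n)
        rwa [h2, hn] at this)
    obtain ⟨y, hy⟩ := exists_clusterPt_of_compactSpace (map (fun j : ℕ => f^[n * j] x) atTop)
    have hy : MapClusterPt y atTop (fun j : ℕ => f^[n * j] x) := hy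
    refine ⟨y, omega_CR hf (by omega) hy, fun k hk => ?_⟩
    have hcl : IsClosed {w : X | dist (f^[k] w) (z k) ≤ e} :=
      isClosed_le ((hf.iterate k).dist continuous_const) continuous_const
    refine hcl.mem_of_mapClusterPt hy (Eventually.of_forall fun j => ?_)
    have := hx (k + n * j)
    rw [Nat.add_mul_mod_self_left, Nat.mod_eq_of_lt (by omega), Function.iterate_add_apply] at this
    exact this.le
  choose y hyC hy using step
  obtain ⟨w, hw⟩ := exists_clusterPt_of_compactSpace (map y atTop)
  have hw : MapClusterPt w atTop y := hw
  refine ⟨w, (isClosed_CR hf).mem_of_mapClusterPt hw (Eventually.of_forall hyC), fun k => ?_⟩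
  have hcl : IsClosed {w : X | dist (f^[k] w) (z k) ≤ e} :=
    isClosed_le ((hf.iterate k).dist continuous_const) continuous_const
  refine hcl.mem_of_mapClusterPt hw ?_
  filter_upwards [eventually_ge_atTop k] with m hm
  exact hy m k hm


lemma uniform_to [CompactSpace X] {f : X → X} (hf : Continuous f) {y : X} {D : Set X}
    (hD : ∀ x ∈ D, ∀ δ > 0, ChainStable f δ x y) {δ : ℝ} (hδ : 0 < δ) :
    ∃ L : ℕ, ∀ x ∈ D, ∃ n c, 1 ≤ n ∧ n ≤ L ∧ c 0 = x ∧ c n = y ∧ PC f δ n c := by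
  obtain ⟨δ0, h0, hp⟩ := perturb hf hδ
  obtain ⟨t, htD, htf, hcov⟩ := Metric.finite_approx_of_totallyBounded
    (isCompact_univ.totallyBounded.subset (subset_univ D)) δ0 h0
  have hch : ∀ a : X, ∃ n : ℕ, a ∈ t → ∃ c, 1 ≤ n ∧ c 0 = a ∧ c n = y ∧ PC f δ0 n c := by
    intro a
    by_cases ha : a ∈ t
    · obtain ⟨n, c, h⟩ := chain_of_stable h0 (hD a (htD ha) δ0 h0)
      exact ⟨n, fun _ => ⟨c, h⟩⟩
    · exact ⟨0, fun h => absurd h ha⟩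
  choose N hN using hch
  refine ⟨htf.toFinset.sup N, fun x hx => ?_⟩
  obtain ⟨a, ha, hxa⟩ := mem_iUnion₂.1 (hcov hx)
  obtain ⟨c, h1, hc0, hcn, hc⟩ := hN a ha
  refine ⟨N a, fun i => if i = 0 then x else c i, h1,
    Finset.le_sup (f := N) (htf.mem_toFinset.2 ha), by simp, ?_, hp _ c _ hc fun i => ?_⟩
  · simp [show N a ≠ 0 by omega, hcn]
  · by_cases h : i = 0
    · subst h; simpa [hc0] using hxa
    · simp [h, h0]

lemma uniform_from [CompactSpace X] {f : X → X} (hf : Continuous f) {y : X} {D : Set X}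
    (hD : ∀ x ∈ D, ∀ δ > 0, ChainStable f δ y x) {δ : ℝ} (hδ : 0 < δ) :
    ∃ L : ℕ, ∀ x ∈ D, ∃ n c, 1 ≤ n ∧ n ≤ L ∧ c 0 = y ∧ c n = x ∧ PC f δ n c := by
  obtain ⟨δ0, h0, hp⟩ := perturb hf hδ
  obtain ⟨t, htD, htf, hcov⟩ := Metric.finite_approx_of_totallyBounded
    (isCompact_univ.totallyBounded.subset (subset_univ D)) δ0 h0
  have hch : ∀ a : X, ∃ n : ℕ, a ∈ t → ∃ c, 1 ≤ n ∧ c 0 = y ∧ c n = a ∧ PC f δ0 n c := by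
    intro a
    by_cases ha : a ∈ t
    · obtain ⟨n, c, h⟩ := chain_of_stable h0 (hD a (htD ha) δ0 h0)
      exact ⟨n, fun _ => ⟨c, h⟩⟩
    · exact ⟨0, fun h => absurd h ha⟩
  choose N hN using hch
  refine ⟨htf.toFinset.sup N, fun x hx => ?_⟩
  obtain ⟨a, ha, hxa⟩ := mem_iUnion₂.1 (hcov hx)
  obtain ⟨c, h1, hc0, hcn, hc⟩ := hN a ha
  refine ⟨N a, fun i => if i = N a then x else c i, h1,
    Finset.le_sup (f := N) (htf.mem_toFinset.2 ha), ?_, by simp, hp _ c _ hc fun i => ?_⟩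
  · simp [show 0 ≠ N a by omega, hc0]
  · by_cases h : i = N a
    · subst h; simpa [hcn] using hxa
    · simp [h, h0]

lemma stable_image [CompactSpace X] {f : X → X} (hf : Continuous f) {x y : X}
    (hy : y ∈ ChainRecurrent f) (hx : ∀ δ > 0, ChainStable f δ x y) :
    ∀ δ > 0, ChainStable f δ (f x) y := by
  intro δ hδ
  obtain ⟨δ0, h0, hp⟩ := perturb hf hδ
  obtain ⟨n, c, hn, hc0, hcn, hc⟩ := chain_of_stable h0 (hx δ0 h0)
  obtain ⟨m, c', hm, hc0', hcm, hc'⟩ := chain_of_stable h0 (mem_CR_iff.1 hy δ0 h0)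
  have hj : c n = c' 0 := by rw [hcn, hc0']
  have hPC := PC_append hc hc' hj
  have e0 : app n c c' 0 = x := by rw [app_le _ _ _ hj 0 (by omega), hc0]
  have e1 : app n c c' (n + m) = y := by rw [app_add, hcm]
  generalize app n c c' = w at *
  have hs : PC f δ0 (n + m - 1) (fun i => w (i + 1)) := fun i hi => hPC (i + 1) (by omega)
  refine stable_of_chain (n := n + m - 1) (c := fun i => if i = 0 then f x else w (i + 1))
    (by omega) (by simp) ?_ (hp _ _ _ hs fun i => ?_)
  · simp only [show n + m - 1 ≠ 0 by omega, if_false]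
    rw [show n + m - 1 + 1 = n + m by omega, e1]
  · by_cases h : i = 0
    · subst h
      have := hPC 0 (by omega)
      rw [e0] at this
      simpa using this
    · simp [h, h0]

lemma exists_loops [CompactSpace X] {f : X → X} (hf : Continuous f) {y : X}
    (hy : y ∈ ChainRecurrent f) {δ : ℝ} (hδ : 0 < δ) :
    ∃ L : ℕ, ∀ x ∈ ChainClassOf f y, ∀ n : ℕ, ∃ l₁ l₂ c, l₁ ≤ L ∧ l₂ ≤ L ∧ 1 ≤ l₁ ∧
      c 0 = y ∧ c (l₁ + n + l₂) = y ∧ PC f δ (l₁ + n + l₂) c ∧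
      ∀ i < n, c (l₁ + i) = f^[i] x := by
  obtain ⟨L₁, h1⟩ := uniform_to hf (y := y) (D := {x | ∀ δ > 0, ChainStable f δ x y})
    (fun x hx => hx) hδ
  obtain ⟨L₂, h2⟩ := uniform_from hf (y := y) (D := {x | ∀ δ > 0, ChainStable f δ y x})
    (fun x hx => hx) hδ
  refine ⟨max L₁ L₂, fun x hx n => ?_⟩
  have hx1 : ∀ k, ∀ δ > 0, ChainStable f δ (f^[k] x) y := by
    intro k
    induction k with
    | zero => exact fun δ hδ => (hx.2 δ hδ).1
    | succ k ih => rw [Function.iterate_succ_apply']; exact stable_image hf hy ih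
  obtain ⟨n₁, c₁, a1, b1, d1, e1, p1⟩ := h1 _ (hx1 n)
  obtain ⟨n₂, c₂, a2, b2, d2, e2, p2⟩ := h2 x (fun δ hδ => (hx.2 δ hδ).2)
  have po : PC f δ n (fun i => f^[i] x) := by
    intro i _
    simp only [Function.iterate_succ_apply', dist_self]; exact hδ
  have j1 : c₂ n₂ = (fun i => f^[i] x) 0 := by simp [e2]
  have p3 := PC_append p2 po j1
  have j2 : app n₂ c₂ (fun i => f^[i] x) (n₂ + n) = c₁ 0 := by rw [app_add, d1]
  refine ⟨n₂, n₁, _, le_max_of_le_right b2, le_max_of_le_left b1, a2, ?_, ?_,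
    PC_append p3 p1 j2, ?_⟩
  · rw [app_le _ _ _ j2 0 (by omega), app_le _ _ _ j1 0 (by omega), d2]
  · rw [app_add, e1]
  · intro i hi
    rw [app_le _ _ _ j2 _ (by omega), app_add]

lemma exists_maximal_sep {f : X → X} {Y : Set X} {n : ℕ} {e b : ℝ}
    (he : 0 < e)
    (hb : ∀ E : Finset X, (E : Set X) ⊆ Y →
      (∀ x ∈ E, ∀ x' ∈ E, x ≠ x' → ∃ i < n, e ≤ dist (f^[i] x) (f^[i] x')) →
      (E.card : ℝ) ≤ b) :
    ∃ E : Finset X, (E.card : ℝ) ≤ b ∧ Y ⊆ ⋃ x ∈ E, bowenBall f n x e := by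
  classical
  let P : ℕ → Prop := fun k => ∃ E : Finset X, (E : Set X) ⊆ Y ∧
      (∀ x ∈ E, ∀ x' ∈ E, x ≠ x' → ∃ i < n, e ≤ dist (f^[i] x) (f^[i] x')) ∧ E.card = k
  have hP0 : P 0 := ⟨∅, by simp, by simp, by simp⟩
  have hPb : ∀ k, P k → k ≤ ⌊b⌋₊ := by
    rintro k ⟨E, h1, h2, rfl⟩
    exact Nat.le_floor (hb E h1 h2)
  obtain ⟨E, hE, hsep, hcard⟩ := Nat.findGreatest_spec (P := P) (Nat.zero_le ⌊b⌋₊) hP0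
  refine ⟨E, hb E hE hsep, fun y hy => ?_⟩
  by_contra hcon
  simp only [mem_iUnion, not_exists] at hcon
  have hfar : ∀ x ∈ E, ∃ i < n, e ≤ dist (f^[i] x) (f^[i] y) := by
    intro x hx
    have := hcon x hx
    by_contra hno
    push Not at hno
    exact this hno
  have hyE : y ∉ E := by
    intro h
    obtain ⟨i, _, hi⟩ := hfar y h
    rw [dist_self] at hi; linarith
  have hP : P (E.card + 1) := by
    refine ⟨insert y E, ?_, ?_, Finset.card_insert_of_notMem hyE⟩
    · rw [Finset.coe_insert]; exact insert_subset hy hE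
    · intro x hx x' hx' hne
      rcases Finset.mem_insert.1 hx with h1 | h1 <;> rcases Finset.mem_insert.1 hx' with h2 | h2
      · exact absurd (h1.trans h2.symm) hne
      · obtain ⟨i, h3, h4⟩ := hfar x' h2
        exact ⟨i, h3, by rw [h1, dist_comm]; exact h4⟩
      · rw [h2]; exact hfar x h1
      · exact hsep x h1 x' h2 hne
  have := Nat.le_findGreatest (hPb _ hP) hP
  omega

lemma bowenC_mono (f : X → X) (Z : Set X) (t e : ℝ) : Monotone (bowenC f Z t e) := by
  intro m n hmn
  unfold bowenC
  refine iInf_mono fun c => iInf_mono fun v => ?_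
  exact le_iInf fun h => iInf_le_of_le (fun i => hmn.trans (h i)) le_rfl

lemma bowenC_le {f : X → X} {Z : Set X} {t e : ℝ} (p : X) {n : ℕ} (E : Finset X)
    (hE : Z ⊆ ⋃ x ∈ E, bowenBall f n x e) :
    bowenC f Z t e n ≤ E.card * ENNReal.ofReal (Real.exp (-t * n)) +
      ENNReal.ofReal (Real.exp (-t * n)) * (1 - ENNReal.ofReal (Real.exp (-t)))⁻¹ := by
  classical
  let c : ℕ → X := fun i => if h : i < E.card then (E.equivFin.symm ⟨i, h⟩ : X) else p
  let v : ℕ → ℕ := fun i => if i < E.card then n else n + i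
  have hv : ∀ i, n ≤ v i := by
    intro i; simp only [v]; split_ifs <;> omega
  have hcov : Z ⊆ ⋃ i, bowenBall f (v i) (c i) e := by
    intro z hz
    obtain ⟨x, hx, hzx⟩ := mem_iUnion₂.1 (hE hz)
    refine mem_iUnion.2 ⟨(E.equivFin ⟨x, hx⟩ : ℕ), ?_⟩
    have h1 : (E.equivFin ⟨x, hx⟩ : ℕ) < E.card := (E.equivFin ⟨x, hx⟩).2
    have h2 : c (E.equivFin ⟨x, hx⟩ : ℕ) = x := by simp [c]
    have h3 : v (E.equivFin ⟨x, hx⟩ : ℕ) = n := by simp [v]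
    rw [h2, h3]; exact hzx
  unfold bowenC
  refine (iInf₂_le_of_le c v (iInf₂_le_of_le hv hcov le_rfl)).trans ?_
  have hle : ∀ i, ENNReal.ofReal (Real.exp (-t * v i)) ≤
      (if i ∈ Finset.range E.card then ENNReal.ofReal (Real.exp (-t * n)) else 0) +
      ENNReal.ofReal (Real.exp (-t * n)) * ENNReal.ofReal (Real.exp (-t)) ^ i := by
    intro i
    by_cases h : i < E.card
    · simp [v, h]
    · simp only [v, h, if_false, Finset.mem_range, zero_add]
      rw [← ENNReal.ofReal_pow (Real.exp_pos _).le, ← ENNReal.ofReal_mul (Real.exp_pos _).le,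
        ← Real.exp_nat_mul, ← Real.exp_add]
      apply le_of_eq; congr 2; push_cast; ring
  refine (ENNReal.tsum_le_tsum hle).trans ?_
  rw [ENNReal.tsum_add, ENNReal.tsum_mul_left, ENNReal.tsum_geometric]
  gcongr
  rw [tsum_eq_sum (s := Finset.range E.card) (by intro b hb; simp [hb])]
  rw [Finset.sum_ite_mem]
  simp

lemma exists_sep [Nonempty X] {f : X → X} {Y : Set X} {e s : ℝ} (he : 0 < e) (hs : 0 < s)
    (h : ENNReal.ofReal s < bowenH f Y e) (n0 : ℕ) :
    ∃ n ≥ n0, ∃ E : Finset X, (E : Set X) ⊆ Y ∧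
      (∀ x ∈ E, ∀ x' ∈ E, x ≠ x' → ∃ i < n, e ≤ dist (f^[i] x) (f^[i] x')) ∧
      Real.exp (s * n) < E.card := by
  by_contra hcon
  push Not at hcon
  refine absurd h (not_lt.2 ?_)
  obtain ⟨p⟩ := ‹Nonempty X›
  have hcl : ∀ t, s < t → bowenCLim f Y t e = 0 := by
    intro t hst
    have hbd : ∀ n ≥ n0, bowenC f Y t e n ≤ ENNReal.ofReal (Real.exp (-(t - s)) ^ n) +
        ENNReal.ofReal (Real.exp (-t) ^ n) * (1 - ENNReal.ofReal (Real.exp (-t)))⁻¹ := by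
      intro n hn
      obtain ⟨E, hE, hcov⟩ := exists_maximal_sep (f := f) (n := n) he (hcon n hn)
      refine (bowenC_le p E hcov).trans ?_
      have e1 : Real.exp (-t * n) = Real.exp (-t) ^ n := by
        rw [← Real.exp_nat_mul]; congr 1; ring
      rw [e1]
      gcongr
      rw [← ENNReal.ofReal_natCast, ← ENNReal.ofReal_mul (by positivity)]
      apply ENNReal.ofReal_le_ofReal
      calc (E.card : ℝ) * Real.exp (-t) ^ n ≤ Real.exp (s * n) * Real.exp (-t) ^ n := by gcongr
        _ = Real.exp (-(t - s)) ^ n := by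
          rw [← Real.exp_nat_mul, ← Real.exp_nat_mul, ← Real.exp_add]; congr 1; ring
    have hlim : Tendsto (fun n : ℕ => ENNReal.ofReal (Real.exp (-(t - s)) ^ n) +
        ENNReal.ofReal (Real.exp (-t) ^ n) * (1 - ENNReal.ofReal (Real.exp (-t)))⁻¹)
        atTop (𝓝 0) := by
      have a1 : ∀ r : ℝ, 0 < r → Tendsto (fun n : ℕ => ENNReal.ofReal (Real.exp (-r) ^ n))
          atTop (𝓝 0) := by
        intro r hr
        have := ENNReal.tendsto_ofReal (tendsto_pow_atTop_nhds_zero_of_lt_one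
          (Real.exp_pos (-r)).le (by rw [Real.exp_lt_one_iff]; linarith))
        simpa using this
      have hfin : (1 - ENNReal.ofReal (Real.exp (-t)))⁻¹ ≠ ∞ := by
        rw [ENNReal.inv_ne_top]
        apply ne_of_gt
        rw [tsub_pos_iff_lt, ← ENNReal.ofReal_one]
        exact (ENNReal.ofReal_lt_ofReal_iff one_pos).2 (by
          rw [Real.exp_lt_one_iff]; linarith)
      have := (a1 (t - s) (by linarith)).add
        (ENNReal.Tendsto.mul_const (a1 t (by linarith)) (Or.inr hfin))
      simpa using this
    unfold bowenCLim
    rw [ENNReal.iSup_eq_zero]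
    intro m
    refine le_antisymm (ge_of_tendsto hlim ?_) zero_le
    filter_upwards [eventually_ge_atTop (max m n0)] with n hn
    exact (bowenC_mono f Y t e (le_of_max_le_left hn)).trans (hbd n (le_of_max_le_right hn))
  have hle : ∀ t, s < t → bowenH f Y e ≤ ENNReal.ofReal t := fun t ht =>
    sInf_le ⟨t, hcl t ht, rfl⟩
  have ht : Tendsto (fun t : ℝ => ENNReal.ofReal t) (𝓝[>] s) (𝓝 (ENNReal.ofReal s)) :=
    (ENNReal.continuous_ofReal.tendsto s).mono_left nhdsWithin_le_nhds
  exact ge_of_tendsto ht (eventually_mem_nhdsWithin.mono hle)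


lemma sum_blocks (g : ℕ → ℝ) (Q J : ℕ) :
    ∑ k ∈ Finset.range (J * Q), g k =
      ∑ j ∈ Finset.range J, ∑ i ∈ Finset.range Q, g (j * Q + i) := by
  induction J with
  | zero => simp
  | succ J ih => rw [Nat.succ_mul, Finset.sum_range_add, ih, Finset.sum_range_succ]

open Classical in
/-- Mass distribution: a separated family coded by a full shift forces entropy. -/
lemma lower_entropy {ι : Type*} [Fintype ι] [Nonempty ι] {f : X → X} {Z : Set X}
    {Q : ℕ} (hQ : 1 ≤ Q) {s e : ℝ} (hs : 0 ≤ s)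
    (hcard : Real.exp (s * Q) ≤ Fintype.card ι) (y : (ℕ → ι) → X) (hy : ∀ σ, y σ ∈ Z)
    (hsep : ∀ σ σ' : ℕ → ι, ∀ m j : ℕ, j < m → σ j ≠ σ' j →
      ∃ k < m * Q, 2 * e ≤ dist (f^[k] (y σ)) (f^[k] (y σ'))) :
    ENNReal.ofReal s ≤ bowenH f Z e := by
  have hcardpos : (0 : ℝ) < Fintype.card ι := by exact_mod_cast Fintype.card_pos
  have key : ENNReal.ofReal (Real.exp (-(s * Q))) ≤ bowenC f Z s e 0 := by
    unfold bowenC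
    refine le_iInf fun c => le_iInf fun v => le_iInf fun _ => le_iInf fun hcov => ?_
    let _ : MeasurableSpace ι := ⊤
    let ν : Measure ι := (PMF.uniformOfFintype ι).toMeasure
    let μ : Measure (ℕ → ι) := Measure.infinitePi (fun _ : ℕ => ν)
    have hμ : μ univ = 1 := measure_univ
    have hball : ∀ i, μ {σ | y σ ∈ bowenBall f (v i) (c i) e} ≤
        ENNReal.ofReal (Real.exp (s * Q)) * ENNReal.ofReal (Real.exp (-s * v i)) := by
      intro i
      rcases Set.eq_empty_or_nonempty {σ | y σ ∈ bowenBall f (v i) (c i) e} with h0 | ⟨σ₀, h0⟩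
      · rw [h0]; simp
      · have hsub : {σ | y σ ∈ bowenBall f (v i) (c i) e} ⊆
            Set.pi (Finset.range (v i / Q) : Finset ℕ) (fun j => {σ₀ j}) := by
          intro σ hσ j hj
          by_contra hne
          obtain ⟨k, hk, hd⟩ := hsep σ σ₀ (v i / Q) j (by simpa using hj) hne
          have hk' : k < v i := hk.trans_le (Nat.div_mul_le_self _ _)
          have a1 : dist (f^[k] (c i)) (f^[k] (y σ)) < e := hσ k hk'
          have a2 : dist (f^[k] (c i)) (f^[k] (y σ₀)) < e := h0 k hk'
          have := dist_triangle_left (f^[k] (y σ)) (f^[k] (y σ₀)) (f^[k] (c i))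
          linarith
        refine (measure_mono hsub).trans ?_
        rw [Measure.infinitePi_pi _ (fun _ _ => MeasurableSet.singleton _)]
        have h1 : ∀ a : ι, ν {a} = ENNReal.ofReal ((Fintype.card ι : ℝ)⁻¹) := by
          intro a
          rw [PMF.toMeasure_apply_singleton _ _ (MeasurableSet.singleton _)]
          rw [PMF.uniformOfFintype_apply, ENNReal.ofReal_inv_of_pos hcardpos,
            ENNReal.ofReal_natCast]
        simp only [h1, Finset.prod_const, Finset.card_range]
        rw [← ENNReal.ofReal_pow (by positivity), ← ENNReal.ofReal_mul (Real.exp_pos _).le]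
        apply ENNReal.ofReal_le_ofReal
        have h2 : (Fintype.card ι : ℝ)⁻¹ ≤ Real.exp (-(s * Q)) := by
          rw [Real.exp_neg]
          exact inv_anti₀ (Real.exp_pos _) hcard
        calc ((Fintype.card ι : ℝ)⁻¹) ^ (v i / Q) ≤ (Real.exp (-(s * Q))) ^ (v i / Q) := by
              gcongr
          _ = Real.exp (-(s * (Q * (v i / Q : ℕ)))) := by
              rw [← Real.exp_nat_mul]; congr 1; ring
          _ ≤ Real.exp (s * Q + -s * v i) := by
              apply Real.exp_le_exp.2
              have h3 : v i ≤ Q * (v i / Q) + Q := by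
                have := Nat.div_add_mod (v i) Q
                have := Nat.mod_lt (v i) (show Q > 0 by omega)
                omega
              have h4 : (v i : ℝ) ≤ Q * (v i / Q : ℕ) + Q := by exact_mod_cast h3
              nlinarith
          _ = _ := Real.exp_add _ _
    have huniv : (univ : Set (ℕ → ι)) ⊆ ⋃ i, {σ | y σ ∈ bowenBall f (v i) (c i) e} := by
      intro σ _
      obtain ⟨i, hi⟩ := mem_iUnion.1 (hcov (hy σ))
      exact mem_iUnion.2 ⟨i, hi⟩
    have h1 : 1 ≤ ENNReal.ofReal (Real.exp (s * Q)) *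
        ∑' i, ENNReal.ofReal (Real.exp (-s * v i)) := by
      rw [← ENNReal.tsum_mul_left, ← hμ]
      exact (measure_mono huniv).trans ((measure_iUnion_le _).trans (ENNReal.tsum_le_tsum hball))
    calc ENNReal.ofReal (Real.exp (-(s * Q))) = ENNReal.ofReal (Real.exp (-(s * Q))) * 1 := by simp
      _ ≤ ENNReal.ofReal (Real.exp (-(s * Q))) * (ENNReal.ofReal (Real.exp (s * Q)) *
        ∑' i, ENNReal.ofReal (Real.exp (-s * v i))) := by gcongr
      _ = _ := by
        rw [← mul_assoc, ← ENNReal.ofReal_mul (Real.exp_pos _).le, ← Real.exp_add]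
        simp
  unfold bowenH
  refine le_sInf ?_
  rintro _ ⟨t, ht, rfl⟩
  by_contra hlt
  have hts : t < s := by
    by_contra h
    exact hlt (ENNReal.ofReal_le_ofReal (not_lt.1 h))
  have h1 : bowenC f Z s e 0 ≤ bowenC f Z t e 0 := by
    unfold bowenC
    refine iInf_mono fun c => iInf_mono fun v => iInf_mono fun _ => iInf_mono fun _ => ?_
    refine ENNReal.tsum_le_tsum fun i => ENNReal.ofReal_le_ofReal (Real.exp_le_exp.2 ?_)
    have : (0 : ℝ) ≤ v i := Nat.cast_nonneg _
    nlinarith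
  have h2 : bowenC f Z t e 0 ≤ bowenCLim f Z t e := le_iSup (bowenC f Z t e) 0
  have ht' : bowenCLim f Z t e = 0 := ht
  rw [ht'] at h2
  have h3 := (key.trans h1).trans h2
  have h4 : 0 < ENNReal.ofReal (Real.exp (-(s * Q))) := ENNReal.ofReal_pos.2 (Real.exp_pos _)
  exact absurd h3 (not_le.2 h4)

/-- The oscillating selector of block types. -/
def tau (j : ℕ) : Prop := j ≠ 0 ∧ Even (Nat.log 2 j)

open Classical in
lemma cnt_succ (m : ℕ) : ((Finset.range (2 ^ (m + 1))).filter tau).card =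
    ((Finset.range (2 ^ m)).filter tau).card + if Even m then 2 ^ m else 0 := by
  have h : Finset.range (2 ^ (m + 1)) = Finset.range (2 ^ m) ∪ Finset.Ico (2 ^ m) (2 ^ (m + 1)) := by
    ext j
    simp only [Finset.mem_range, Finset.mem_union, Finset.mem_Ico, pow_succ]
    omega
  have hd : Disjoint (Finset.range (2 ^ m)) (Finset.Ico (2 ^ m) (2 ^ (m + 1))) := by
    rw [Finset.range_eq_Ico]; exact Finset.Ico_disjoint_Ico_consecutive _ _ _
  rw [h, Finset.filter_union, Finset.card_union_of_disjoint (Finset.disjoint_filter_filter hd)]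
  congr 1
  have hl : ∀ j ∈ Finset.Ico (2 ^ m) (2 ^ (m + 1)), (tau j ↔ Even m) := by
    intro j hj
    rw [Finset.mem_Ico] at hj
    have h0 : j ≠ 0 := by
      have : 0 < 2 ^ m := by positivity
      omega
    have : Nat.log 2 j = m := (Nat.log_eq_iff (Or.inr ⟨by norm_num, h0⟩)).2 hj
    simp [tau, h0, this]
  rw [Finset.filter_congr hl]
  by_cases hm : Even m
  · simp [hm, pow_succ]; omega
  · simp [hm]

open Classical in
lemma cnt_even (k : ℕ) : 3 * ((Finset.range (2 ^ (2 * k))).filter tau).card + 1 = 2 ^ (2 * k) := by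
  induction k with
  | zero => simp [tau]
  | succ k ih =>
    rw [show 2 * (k + 1) = 2 * k + 1 + 1 by ring, cnt_succ, cnt_succ]
    have h1 : Even (2 * k) := even_two_mul k
    have h2 : ¬ Even (2 * k + 1) := by simp
    simp only [h1, h2, if_true, if_false, pow_succ]
    omega

open Classical in
lemma sum_tau_bounds (g : ℕ → ℝ) (a b : ℝ) (J : ℕ) :
    ((∀ j, tau j → a ≤ g j) → (∀ j, ¬ tau j → b ≤ g j) →
      ((Finset.range J).filter tau).card * (a - b) + J * b ≤ ∑ j ∈ Finset.range J, g j) ∧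
    ((∀ j, tau j → g j ≤ a) → (∀ j, ¬ tau j → g j ≤ b) →
      ∑ j ∈ Finset.range J, g j ≤ ((Finset.range J).filter tau).card * (a - b) + J * b) := by
  have h : ((Finset.range J).filter tau).card * (a - b) + J * b =
      ∑ j ∈ Finset.range J, (if tau j then a else b) := by
    have : ∀ j, (if tau j then a else b) = (if tau j then (a - b) else 0) + b := by
      intro j; split_ifs <;> ring
    simp only [this, Finset.sum_add_distrib, ← Finset.sum_filter, Finset.sum_const,
      nsmul_eq_mul, Finset.card_range]
  rw [h]
  constructor
  · intro h1 h2
    refine Finset.sum_le_sum fun j _ => ?_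
    split_ifs with hj
    · exact h1 j hj
    · exact h2 j hj
  · intro h1 h2
    refine Finset.sum_le_sum fun j _ => ?_
    split_ifs with hj
    · exact h1 j hj
    · exact h2 j hj

lemma irregular_of_blocks_s16 {f : X → X} {Φ : X → ℝ} {y : X} {Q : ℕ} (hQ : 1 ≤ Q)
    {a₁ a₂ b₁ b₂ : ℝ} (hab₁ : b₁ ≤ a₁) (hab₂ : b₂ ≤ a₂)
    (hgap : a₂ / 3 + 2 * b₂ / 3 < a₁ / 2 + b₁ / 2)
    (hA : ∀ j, tau j → ∑ i ∈ Finset.range Q, Φ (f^[j * Q + i] y) ∈ Icc a₁ a₂)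
    (hB : ∀ j, ¬ tau j → ∑ i ∈ Finset.range Q, Φ (f^[j * Q + i] y) ∈ Icc b₁ b₂) :
    y ∈ IrregularSet f Φ := by
  classical
  rintro ⟨l, hl⟩
  have hQ' : (0 : ℝ) < Q := by exact_mod_cast hQ
  set g : ℕ → ℝ := fun j => ∑ i ∈ Finset.range Q, Φ (f^[j * Q + i] y) with hg
  have havg : ∀ J : ℕ, 1 ≤ J → birkhoffAvg f Φ (J * Q) y * Q * J = ∑ j ∈ Finset.range J, g j := by
    intro J hJ
    have : (J : ℝ) ≠ 0 := by positivity
    unfold birkhoffAvg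
    rw [sum_blocks (fun k => Φ (f^[k] y))]
    push_cast
    field_simp
    rfl
  have hto : ∀ u : ℕ → ℕ, (∀ k, k ≤ u k) → Tendsto (fun k => birkhoffAvg f Φ (u k * Q) y) atTop (𝓝 l) := by
    intro u hu
    refine hl.comp (tendsto_atTop_mono (fun k => ?_) tendsto_id)
    exact (hu k).trans (Nat.le_mul_of_pos_right _ hQ)
  have hpw : ∀ m : ℕ, m ≤ 2 ^ m := fun m => Nat.lt_two_pow_self.le
  have hlow : (a₁ / 2 + b₁ / 2) / Q ≤ l := by
    refine ge_of_tendsto' (hto (fun k => 2 ^ (2 * k + 1)) fun k => by have := hpw (2*k+1); omega) fun k => ?_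
    have h1 := (sum_tau_bounds g a₁ b₁ (2 ^ (2 * k + 1))).1 (fun j hj => (hA j hj).1)
      (fun j hj => (hB j hj).1)
    rw [← havg _ Nat.one_le_two_pow, cnt_succ] at h1
    simp only [even_two_mul, if_true] at h1
    rw [div_le_iff₀ hQ']
    push_cast at h1
    generalize birkhoffAvg f Φ (2 ^ (2 * k + 1) * Q) y = A at h1 ⊢
    rw [pow_succ] at h1
    have h2 : (0 : ℝ) < 2 ^ (2 * k) := by positivity
    have h3 : (0 : ℝ) ≤ ((Finset.range (2 ^ (2 * k))).filter tau).card := Nat.cast_nonneg _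
    have h4 : (0 : ℝ) ≤ ((Finset.range (2 ^ (2 * k))).filter tau).card * (a₁ - b₁) :=
      mul_nonneg h3 (by linarith)
    have h5 : (2 : ℝ) ^ (2 * k) * (a₁ + b₁) ≤
      2 ^ (2 * k) * (2 * (A * Q)) := by linarith
    have := le_of_mul_le_mul_left h5 h2
    linarith
  have hupp : l ≤ (a₂ / 3 + 2 * b₂ / 3) / Q := by
    refine le_of_tendsto' (hto (fun k => 2 ^ (2 * k)) fun k => by have := hpw (2*k); omega) fun k => ?_
    have h1 := (sum_tau_bounds g a₂ b₂ (2 ^ (2 * k))).2 (fun j hj => (hA j hj).2)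
      (fun j hj => (hB j hj).2)
    rw [← havg _ Nat.one_le_two_pow] at h1
    have hc := cnt_even k
    have hc' : (3 : ℝ) * ((Finset.range (2 ^ (2 * k))).filter tau).card + 1 = 2 ^ (2 * k) := by
      exact_mod_cast hc
    rw [le_div_iff₀ hQ']
    push_cast at h1
    have h2 : (0 : ℝ) < 2 ^ (2 * k) := by positivity
    have h4 : (((Finset.range (2 ^ (2 * k))).filter tau).card : ℝ) * (a₂ - b₂) ≤
       (2 ^ (2 * k) / 3) * (a₂ - b₂) :=
      mul_le_mul_of_nonneg_right (by linarith) (by linarith)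
    have h5 : (2 : ℝ) ^ (2 * k) * (birkhoffAvg f Φ (2 ^ (2 * k) * Q) y * Q) ≤
      2 ^ (2 * k) * (a₂ / 3 + 2 * b₂ / 3) := by linarith
    exact le_of_mul_le_mul_left h5 h2
  have := hlow.trans hupp
  rw [div_le_div_iff_of_pos_right hQ'] at this
  linarith


/-- Concatenation of sequences, each used for `Q` steps. -/
def cat (Q : ℕ) (l : ℕ → ℕ → X) : ℕ → X := fun k => l (k / Q) (k % Q)

lemma cat_add {Q : ℕ} (l : ℕ → ℕ → X) (j i : ℕ) (hi : i < Q) : cat Q l (j * Q + i) = l j i := by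
  have hQ : 0 < Q := by omega
  unfold cat
  rw [mul_comm, Nat.mul_add_div hQ, Nat.mul_add_mod, Nat.div_eq_of_lt hi, Nat.mod_eq_of_lt hi,
    add_zero]

lemma cat_mul {Q : ℕ} (hQ : 1 ≤ Q) (l : ℕ → ℕ → X) (j : ℕ) : cat Q l (j * Q) = l j 0 :=
  cat_add l j 0 (by omega)

lemma cat_PC {f : X → X} {δ : ℝ} {Q J : ℕ} (hQ : 1 ≤ Q) {p : X} {l : ℕ → ℕ → X}
    (h0 : ∀ j ≤ J, l j 0 = p) (hl : ∀ j < J, l j Q = p) (hp : ∀ j < J, PC f δ Q (l j)) :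
    PC f δ (J * Q) (cat Q l) := by
  intro k hk
  have hj : k / Q < J := (Nat.div_lt_iff_lt_mul (by omega)).2 hk
  have hi : k % Q < Q := Nat.mod_lt _ (by omega)
  have hke : k = (k / Q) * Q + k % Q := by rw [mul_comm]; exact (Nat.div_add_mod k Q).symm
  generalize k / Q = j at *
  generalize k % Q = i at *
  subst hke
  rw [cat_add _ _ _ hi]
  have := hp j hj i hi
  by_cases h1 : i + 1 < Q
  · rw [add_assoc, cat_add _ _ _ h1]; exact this
  · have h2 : i + 1 = Q := by omega
    rw [add_assoc, h2, show j * Q + Q = (j + 1) * Q by ring, cat_mul hQ, h0 (j + 1) hj]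
    rw [h2, hl j hj] at this
    exact this

/-- A separated family of `δ`-loops at `p` of length `N`, with controlled sums. -/
def LoopFam (f : X → X) (Φ : X → ℝ) (δ e : ℝ) (p : X) (N : ℕ) (a b : ℝ) {ι : Type}
    (l : ι → ℕ → X) : Prop :=
  (∀ i, l i 0 = p ∧ l i N = p ∧ PC f δ N (l i) ∧ ∑ k ∈ Finset.range N, Φ (l i k) ∈ Icc a b) ∧
  ∀ i i', i ≠ i' → ∃ k < N, e ≤ dist (l i k) (l i' k)

lemma LoopFam.pow {f : X → X} {Φ : X → ℝ} {δ e : ℝ} {p : X} {N : ℕ} (hN : 1 ≤ N) {a b : ℝ}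
    {ι : Type} {l : ι → ℕ → X} (h : LoopFam f Φ δ e p N a b l) (P : ℕ) :
    ∃ l' : (Fin P → ι) → ℕ → X, LoopFam f Φ δ e p (P * N) (P * a) (P * b) l' := by
  let m : (Fin P → ι) → ℕ → ℕ → X := fun w j => if hj : j < P then l (w ⟨j, hj⟩) else fun _ => p
  have m0 : ∀ w j, m w j 0 = p := by
    intro w j
    simp only [m]
    split_ifs with hj
    · exact (h.1 _).1
    · rfl
  have mj : ∀ w j (hj : j < P), m w j = l (w ⟨j, hj⟩) := by
    intro w j hj
    simp [m, hj]
  refine ⟨fun w => cat N (m w), fun w => ⟨?_, ?_, ?_, ?_⟩, ?_⟩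
  · have := cat_mul hN (m w) 0
    rw [zero_mul] at this
    beta_reduce
    rw [this, m0]
  · beta_reduce
    rw [cat_mul hN, m0]
  · refine cat_PC hN (p := p) (fun j _ => m0 w j) (fun j hj => ?_) (fun j hj => ?_)
    · rw [mj w j hj]; exact (h.1 _).2.1
    · rw [mj w j hj]; exact (h.1 _).2.2.1
  · rw [sum_blocks (fun k => Φ (cat N (m w) k))]
    have hb : ∀ j ∈ Finset.range P, ∑ i ∈ Finset.range N, Φ (cat N (m w) (j * N + i)) ∈ Icc a b := by
      intro j hj
      have hj := Finset.mem_range.1 hj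
      have := (h.1 (w ⟨j, hj⟩)).2.2.2
      rw [← mj w j hj] at this
      rwa [Finset.sum_congr rfl (fun i hi => by rw [cat_add _ _ _ (Finset.mem_range.1 hi)])]
    constructor
    · have := Finset.card_nsmul_le_sum _ _ _ (fun j hj => (hb j hj).1)
      simpa using this
    · have := Finset.sum_le_card_nsmul _ _ _ (fun j hj => (hb j hj).2)
      simpa using this
  · intro w w' hne
    obtain ⟨j, hj⟩ := Function.ne_iff.1 hne
    obtain ⟨k, hk, hd⟩ := h.2 _ _ hj
    refine ⟨j * N + k, ?_, ?_⟩
    · calc (j : ℕ) * N + k < j * N + N := by omega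
        _ = (j + 1) * N := by ring
        _ ≤ P * N := Nat.mul_le_mul_right _ j.2
    · beta_reduce
      rw [cat_add _ _ _ hk, cat_add _ _ _ hk, mj w j j.2, mj w' j j.2]
      exact hd

lemma LoopFam.precat {f : X → X} {Φ : X → ℝ} {δ e : ℝ} {p : X} {R N : ℕ} {a b a' b' : ℝ}
    {ι κ : Type} {l : ι → ℕ → X} (h : LoopFam f Φ δ e p N a b l)
    {l' : κ → ℕ → X} (h' : LoopFam f Φ δ e p R a' b' l') (q : κ) :
    LoopFam f Φ δ e p (R + N) (a' + a) (b' + b) (fun i => app R (l' q) (l i)) := by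
  obtain ⟨q0, q1, q2, q3⟩ := h'.1 q
  refine ⟨fun i => ?_, fun i i' hne => ?_⟩
  · obtain ⟨i0, i1, i2, i3⟩ := h.1 i
    have hj : l' q R = l i 0 := by rw [q1, i0]
    refine ⟨?_, ?_, PC_append q2 i2 hj, ?_⟩
    · beta_reduce
      rw [app_le _ _ _ hj 0 (by omega), q0]
    · beta_reduce
      rw [app_add, i1]
    · rw [Finset.sum_range_add]
      have e1 : ∑ k ∈ Finset.range R, Φ (app R (l' q) (l i) k) =
          ∑ k ∈ Finset.range R, Φ (l' q k) :=
        Finset.sum_congr rfl fun k hk => by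
          rw [app_le _ _ _ hj k (Finset.mem_range.1 hk).le]
      simp only [e1, app_add]
      exact ⟨add_le_add q3.1 i3.1, add_le_add q3.2 i3.2⟩
  · obtain ⟨k, hk, hd⟩ := h.2 i i' hne
    exact ⟨R + k, by omega, by beta_reduce; rw [app_add, app_add]; exact hd⟩

/-- Two separated loop families with different averages yield irregular points with entropy. -/
lemma entropy_of_loops [CompactSpace X] {f : X → X} (hf : Continuous f) {Φ : X → ℝ}
    {e δ e₁ η s : ℝ} {p : X} {Q : ℕ} (hQ : 1 ≤ Q)
    (hs : ∀ z : ℕ → X, (∀ n, dist (f (z n)) (z (n + 1)) < δ) →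
      ∃ y : X, ∀ n, dist (f^[n] y) (z n) < e)
    (hη : ∀ a b : X, dist a b ≤ e → |Φ a - Φ b| ≤ η) (he : 4 * e ≤ e₁)
    {ι : Type} [Fintype ι] [Nonempty ι] (hs0 : 0 ≤ s)
    (hcard : Real.exp (s * Q) ≤ Fintype.card ι)
    {a₁ a₂ b₁ b₂ : ℝ} {u w : ι → ℕ → X}
    (hu : LoopFam f Φ δ e₁ p Q a₁ a₂ u) (hw : LoopFam f Φ δ e₁ p Q b₁ b₂ w)
    (hab₁ : b₁ ≤ a₁) (hab₂ : b₂ ≤ a₂)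
    (hgap : a₂ / 3 + 2 * b₂ / 3 + 2 * (Q * η) < a₁ / 2 + b₁ / 2)
    {Z : Set X}
    (hZ : ∀ y ∈ IrregularSet f Φ, y ∈ ChainRecurrent f → dist y p ≤ e → y ∈ Z) :
    ENNReal.ofReal s ≤ bowenH f Z (e₁ / 4) := by
  classical
  let m : (ℕ → ι) → ℕ → ℕ → X := fun σ j => if tau j then u (σ j) else w (σ j)
  have m0 : ∀ σ j, m σ j 0 = p := by
    intro σ j
    simp only [m]; split_ifs
    exacts [(hu.1 _).1, (hw.1 _).1]
  have m1 : ∀ σ j, m σ j Q = p := by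
    intro σ j
    simp only [m]; split_ifs
    exacts [(hu.1 _).2.1, (hw.1 _).2.1]
  have m2 : ∀ σ j, PC f δ Q (m σ j) := by
    intro σ j
    simp only [m]; split_ifs
    exacts [(hu.1 _).2.2.1, (hw.1 _).2.2.1]
  have hz0 : ∀ σ j, cat Q (m σ) (j * Q) = p := fun σ j => by rw [cat_mul hQ, m0]
  have hz00 : ∀ σ, cat Q (m σ) 0 = p := fun σ => by simpa using hz0 σ 0
  have hpo : ∀ σ n, dist (f (cat Q (m σ) n)) (cat Q (m σ) (n + 1)) < δ := by
    intro σ n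
    refine cat_PC (J := n + 1) hQ (p := p) (fun j _ => m0 σ j) (fun j _ => m1 σ j)
      (fun j _ => m2 σ j) n ?_
    exact Nat.lt_of_lt_of_le (Nat.lt_succ_self n) (Nat.le_mul_of_pos_right _ hQ)
  have hret : ∀ σ k, ∃ n, k < n ∧ cat Q (m σ) n = cat Q (m σ) 0 := fun σ k =>
    ⟨(k + 1) * Q, Nat.lt_of_lt_of_le (Nat.lt_succ_self k) (Nat.le_mul_of_pos_right _ hQ), by
      rw [hz0, hz00]⟩
  choose y hyC hy using fun σ => CR_shadow hf hs (cat Q (m σ)) (hpo σ) (hret σ)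
  have hsum : ∀ σ j, |∑ i ∈ Finset.range Q, Φ (f^[j * Q + i] (y σ)) -
      ∑ i ∈ Finset.range Q, Φ (m σ j i)| ≤ Q * η := by
    intro σ j
    rw [← Finset.sum_sub_distrib]
    refine (Finset.abs_sum_le_sum_abs _ _).trans ?_
    have := Finset.sum_le_card_nsmul (Finset.range Q)
      (fun i => |Φ (f^[j * Q + i] (y σ)) - Φ (m σ j i)|) η (fun i hi => by
        apply hη
        rw [← cat_add (m σ) j i (Finset.mem_range.1 hi)]
        exact hy σ _)
    simpa using this
  refine lower_entropy hQ hs0 hcard y (fun σ => hZ _ ?_ (hyC σ) ?_) ?_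
  · refine irregular_of_blocks_s16 hQ (a₁ := a₁ - Q * η) (a₂ := a₂ + Q * η) (b₁ := b₁ - Q * η)
      (b₂ := b₂ + Q * η) (by linarith) (by linarith) (by linarith) ?_ ?_
    · intro j hj
      have h1 := abs_le.1 (hsum σ j)
      have h2 := (hu.1 (σ j)).2.2.2
      simp only [m, hj, if_true] at h1
      exact ⟨by linarith [h2.1], by linarith [h2.2]⟩
    · intro j hj
      have h1 := abs_le.1 (hsum σ j)
      have h2 := (hw.1 (σ j)).2.2.2
      simp only [m, hj, if_false] at h1
      exact ⟨by linarith [h2.1], by linarith [h2.2]⟩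
  · have := hy σ 0
    rw [hz00] at this
    exact this
  · intro σ σ' M j hj hne
    have : ∃ k < Q, e₁ ≤ dist (m σ j k) (m σ' j k) := by
      simp only [m]; split_ifs
      exacts [hu.2 _ _ hne, hw.2 _ _ hne]
    obtain ⟨k, hk, hd⟩ := this
    refine ⟨j * Q + k, ?_, ?_⟩
    · calc j * Q + k < j * Q + Q := by omega
        _ = (j + 1) * Q := by ring
        _ ≤ M * Q := Nat.mul_le_mul_right _ hj
    · have h1 := hy σ (j * Q + k)
      have h2 := hy σ' (j * Q + k)
      rw [cat_add _ _ _ hk] at h1 h2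
      rw [dist_comm] at h1
      have := dist_triangle4 (m σ j k) (f^[j * Q + k] (y σ)) (f^[j * Q + k] (y σ')) (m σ' j k)
      linarith


lemma loop_sum {f : X → X} {Φ : X → ℝ} {M : ℝ} (hM : ∀ x, |Φ x| ≤ M) {x : X} {n l₁ l₂ : ℕ}
    {c : ℕ → X} (hc : ∀ i < n, c (l₁ + i) = f^[i] x) :
    |∑ k ∈ Finset.range (l₁ + n + l₂), Φ (c k) - ∑ i ∈ Finset.range n, Φ (f^[i] x)| ≤
      (l₁ + l₂) * M := by
  rw [Finset.sum_range_add, Finset.sum_range_add]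
  have h1 : ∑ i ∈ Finset.range n, Φ (c (l₁ + i)) = ∑ i ∈ Finset.range n, Φ (f^[i] x) :=
    Finset.sum_congr rfl fun i hi => by rw [hc i (Finset.mem_range.1 hi)]
  have h2 : ∀ (m : ℕ) (g : ℕ → X), |∑ i ∈ Finset.range m, Φ (g i)| ≤ m * M := by
    intro m g
    refine (Finset.abs_sum_le_sum_abs _ _).trans ?_
    have := Finset.sum_le_card_nsmul (Finset.range m) (fun i => |Φ (g i)|) M (fun i _ => hM _)
    simpa using this
  have h3 := abs_le.1 (h2 l₁ c)
  have h4 := abs_le.1 (h2 l₂ fun i => c (l₁ + n + i))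
  rw [h1, abs_le]
  constructor <;> linarith [h3.1, h3.2, h4.1, h4.2]

/-- The loop property provided by `exists_loops`. -/
def HasLoops (f : X → X) (δ : ℝ) (y : X) (Y : Set X) (L : ℕ) : Prop :=
  ∀ x ∈ Y, ∀ n : ℕ, ∃ l₁ l₂ c, l₁ ≤ L ∧ l₂ ≤ L ∧ 1 ≤ l₁ ∧
      c 0 = y ∧ c (l₁ + n + l₂) = y ∧ PC f δ (l₁ + n + l₂) c ∧
      ∀ i < n, c (l₁ + i) = f^[i] x

lemma single_loop {f : X → X} {Φ : X → ℝ} {M : ℝ} (hM0 : 0 ≤ M) (hM : ∀ x, |Φ x| ≤ M) {δ e : ℝ}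
    {p : X} {Y : Set X} {L : ℕ} (hL : HasLoops f δ p Y L) {x : X} (hx : x ∈ Y) (n : ℕ) :
    ∃ (R : ℕ) (S : ℝ) (l : Unit → ℕ → X), 1 ≤ R ∧ n ≤ R ∧ R ≤ n + 2 * L ∧
      LoopFam f Φ δ e p R S S l ∧ |S - ∑ i ∈ Finset.range n, Φ (f^[i] x)| ≤ 2 * L * M := by
  obtain ⟨l₁, l₂, c, h1, h2, h3, h4, h5, h6, h7⟩ := hL x hx n
  refine ⟨l₁ + n + l₂, ∑ k ∈ Finset.range (l₁ + n + l₂), Φ (c k), fun _ => c, by omega, by omega,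
    by omega, ⟨fun _ => ⟨h4, h5, h6, le_rfl, le_rfl⟩, fun i i' h => absurd rfl h⟩, ?_⟩
  refine (loop_sum hM h7).trans ?_
  have a1 : (l₁ : ℝ) ≤ L := by exact_mod_cast h1
  have a2 : (l₂ : ℝ) ≤ L := by exact_mod_cast h2
  nlinarith

lemma high_loop {f : X → X} {Φ : X → ℝ} {M : ℝ} (hM0 : 0 ≤ M) (hM : ∀ x, |Φ x| ≤ M) {δ e : ℝ}
    {p : X} {Y : Set X} {L : ℕ} (hL : HasLoops f δ p Y L) {α γ : ℝ} (hγ : 0 < γ)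
    (h : ∀ n : ℕ, ∃ x ∈ Y, n * α ≤ ∑ i ∈ Finset.range n, Φ (f^[i] x)) :
    ∃ (R : ℕ) (S : ℝ) (l : Unit → ℕ → X), 1 ≤ R ∧
      LoopFam f Φ δ e p R S S l ∧ R * (α - γ) ≤ S := by
  obtain ⟨n, hn⟩ := exists_nat_ge ((2 * L * M + 2 * L * |α|) / γ)
  rw [div_le_iff₀ hγ] at hn
  obtain ⟨x, hx, hs⟩ := h n
  obtain ⟨R, S, l, h1, h2, h3, h4, h5⟩ := single_loop (e := e) hM0 hM hL hx n
  refine ⟨R, S, l, h1, h4, ?_⟩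
  have a1 : (n : ℝ) ≤ R := by exact_mod_cast h2
  have a2 : (R : ℝ) ≤ n + 2 * L := by exact_mod_cast h3
  have a3 : (R - n) * α ≤ 2 * L * |α| := by
    calc (R - n) * α ≤ (R - n) * |α| := mul_le_mul_of_nonneg_left (le_abs_self α) (by linarith)
      _ ≤ _ := mul_le_mul_of_nonneg_right (by linarith) (abs_nonneg α)
  have a4 := (abs_le.1 h5).1
  nlinarith

lemma low_loop {f : X → X} {Φ : X → ℝ} {M : ℝ} (hM0 : 0 ≤ M) (hM : ∀ x, |Φ x| ≤ M) {δ e : ℝ}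
    {p : X} {Y : Set X} {L : ℕ} (hL : HasLoops f δ p Y L) {α γ : ℝ} (hγ : 0 < γ)
    (h : ∀ n : ℕ, ∃ x ∈ Y, ∑ i ∈ Finset.range n, Φ (f^[i] x) ≤ n * α) :
    ∃ (R : ℕ) (S : ℝ) (l : Unit → ℕ → X), 1 ≤ R ∧
      LoopFam f Φ δ e p R S S l ∧ S ≤ R * (α + γ) := by
  obtain ⟨n, hn⟩ := exists_nat_ge ((2 * L * M + 2 * L * |α|) / γ)
  rw [div_le_iff₀ hγ] at hn
  obtain ⟨x, hx, hs⟩ := h n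
  obtain ⟨R, S, l, h1, h2, h3, h4, h5⟩ := single_loop (e := e) hM0 hM hL hx n
  refine ⟨R, S, l, h1, h4, ?_⟩
  have a1 : (n : ℝ) ≤ R := by exact_mod_cast h2
  have a2 : (R : ℝ) ≤ n + 2 * L := by exact_mod_cast h3
  have a3 : (R - n) * (-α) ≤ 2 * L * |α| := by
    calc (R - n) * (-α) ≤ (R - n) * |α| :=
          mul_le_mul_of_nonneg_left (neg_le_abs α) (by linarith)
      _ ≤ _ := mul_le_mul_of_nonneg_right (by linarith) (abs_nonneg α)
  have a4 := (abs_le.1 h5).2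
  nlinarith

open Classical in
lemma entropy_loops [Nonempty X] {f : X → X} {Φ : X → ℝ} {M : ℝ} (hM0 : 0 ≤ M)
    (hM : ∀ x, |Φ x| ≤ M) {δ e : ℝ} (he : 0 < e)
    {p : X} {Y : Set X} {L : ℕ} (hL : HasLoops f δ p Y L) {s s' κ : ℝ} (hs : 0 < s) (hss : s < s')
    (hκ : 0 < κ) (hH : ENNReal.ofReal s' < bowenH f Y e) :
    ∃ (N k : ℕ) (a b : ℝ) (l : Fin k → ℕ → X), 1 ≤ N ∧ LoopFam f Φ δ e p N a b l ∧
      b - a ≤ κ * N ∧ Real.exp (s * N) ≤ k ∧ a ≤ b := by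
  set B : ℤ := ⌈M / (κ / 2)⌉ with hB
  have hB0 : 0 ≤ B := Int.ceil_nonneg (by positivity)
  let t : Finset (ℕ × ℕ × ℤ) :=
    Finset.range (L + 1) ×ˢ (Finset.range (L + 1) ×ˢ Finset.Icc (-B) B)
  have htne : t.Nonempty := ⟨(0, 0, 0), by simp [t, hB0]⟩
  have htc : (0 : ℝ) < t.card := by exact_mod_cast htne.card_pos
  obtain ⟨n1, hn1⟩ := exists_nat_ge ((2 * L * s + Real.log t.card) / (s' - s))
  obtain ⟨n2, hn2⟩ := exists_nat_ge (4 * L * M / (κ / 2))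
  obtain ⟨n, hn, E, hEY, hEs, hEc⟩ := exists_sep he (hs.trans hss) hH (max (max n1 n2) 1)
  have hn1' : (2 * L * s + Real.log t.card) / (s' - s) ≤ n :=
    hn1.trans (by exact_mod_cast le_trans (le_max_left _ _) (le_of_max_le_left hn))
  have hn2' : 4 * L * M / (κ / 2) ≤ n :=
    hn2.trans (by exact_mod_cast le_trans (le_max_right _ _) (le_of_max_le_left hn))
  have hnpos : 1 ≤ n := le_of_max_le_right hn
  have hnR : (0 : ℝ) < n := by exact_mod_cast hnpos
  rw [div_le_iff₀ (by linarith)] at hn1'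
  rw [div_le_iff₀ (by linarith)] at hn2'
  have hch : ∀ x, ∃ (l₁ l₂ : ℕ) (c : ℕ → X), x ∈ Y → (l₁ ≤ L ∧ l₂ ≤ L ∧ 1 ≤ l₁ ∧
      c 0 = p ∧ c (l₁ + n + l₂) = p ∧ PC f δ (l₁ + n + l₂) c ∧
      ∀ i < n, c (l₁ + i) = f^[i] x) := by
    intro x
    by_cases hx : x ∈ Y
    · obtain ⟨l₁, l₂, c, h⟩ := hL x hx n
      exact ⟨l₁, l₂, c, fun _ => h⟩
    · exact ⟨0, 0, fun _ => x, fun h => absurd h hx⟩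
  choose l₁ l₂ c hc using hch
  let S : X → ℝ := fun x => ∑ i ∈ Finset.range n, Φ (f^[i] x)
  have hSM : ∀ x, |S x| ≤ n * M := by
    intro x
    refine (Finset.abs_sum_le_sum_abs _ _).trans ?_
    have := Finset.sum_le_card_nsmul (Finset.range n) (fun i => |Φ (f^[i] x)|) M (fun i _ => hM _)
    simpa using this
  let g : X → ℕ × ℕ × ℤ := fun x => (l₁ x, l₂ x, ⌊S x / (n * (κ / 2))⌋)
  have hg : ∀ x ∈ E, g x ∈ t := by
    intro x hx
    obtain ⟨h1, h2, -⟩ := hc x (hEY hx)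
    have hd : 0 < (n : ℝ) * (κ / 2) := by positivity
    have h3 := abs_le.1 (hSM x)
    have h5 : M ≤ B * (κ / 2) := (div_le_iff₀ (by positivity)).1 (Int.le_ceil (M / (κ / 2)))
    have h6 : n * M ≤ B * (n * (κ / 2)) := by nlinarith
    simp only [t, g, Finset.mem_product, Finset.mem_range, Finset.mem_Icc]
    refine ⟨by omega, by omega, ?_, ?_⟩
    · rw [Int.le_floor, le_div_iff₀ hd]
      push_cast
      linarith [h3.1]
    · have : S x / (n * (κ / 2)) ≤ B := by
        rw [div_le_iff₀ hd]; linarith [h3.2]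
      exact_mod_cast (Int.floor_le _).trans this
  obtain ⟨⟨m₁, m₂, q⟩, hmt, hm⟩ := Finset.exists_le_card_fiber_of_nsmul_le_card_of_maps_to
    (b := Real.exp (s' * n) / t.card) hg htne (by
      rw [nsmul_eq_mul, mul_div_cancel₀ _ htc.ne']; exact hEc.le)
  set F := E.filter (fun x => g x = (m₁, m₂, q)) with hF
  have hmL : m₁ ≤ L ∧ m₂ ≤ L := by
    simp only [t, Finset.mem_product, Finset.mem_range] at hmt
    omega
  have hFp : ∀ x ∈ F, x ∈ E ∧ l₁ x = m₁ ∧ l₂ x = m₂ ∧ ⌊S x / (n * (κ / 2))⌋ = q := by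
    intro x hx
    have := Finset.mem_filter.1 hx
    simpa [g] using this
  have hmL1 : (m₁ : ℝ) ≤ L := by exact_mod_cast hmL.1
  have hmL2 : (m₂ : ℝ) ≤ L := by exact_mod_cast hmL.2
  refine ⟨m₁ + n + m₂, F.card, q * (n * (κ / 2)) - 2 * L * M,
    (q + 1) * (n * (κ / 2)) + 2 * L * M, fun i => c (F.equivFin.symm i : X), by omega,
    ⟨fun i => ?_, fun i i' hne => ?_⟩, ?_, ?_, ?_⟩
  · obtain ⟨hxE, hx1, hx2, hx3⟩ := hFp _ (F.equivFin.symm i).2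
    beta_reduce
    generalize ((F.equivFin.symm i : F) : X) = x at *
    obtain ⟨h1, h2, h3, h4, h5, h6, h7⟩ := hc x (hEY hxE)
    rw [hx1, hx2] at h5 h6
    rw [hx1] at h7
    refine ⟨h4, h5, h6, ?_⟩
    have h8 := abs_le.1 (loop_sum (l₂ := m₂) hM h7)
    have h9 : ((m₁ : ℝ) + m₂) * M ≤ 2 * L * M := mul_le_mul_of_nonneg_right (by linarith) hM0
    have hd : 0 < (n : ℝ) * (κ / 2) := by positivity
    rw [Int.floor_eq_iff, le_div_iff₀ hd, div_lt_iff₀ hd] at hx3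
    have e1 : S x = ∑ i ∈ Finset.range n, Φ (f^[i] x) := rfl
    rw [e1] at hx3
    exact ⟨by linarith [h8.1, hx3.1], by linarith [h8.2, hx3.2]⟩
  · have hxx : (F.equivFin.symm i : X) ≠ F.equivFin.symm i' := by
      intro h
      exact hne (F.equivFin.symm.injective (Subtype.ext h))
    obtain ⟨hxE, hx1, hx2, hx3⟩ := hFp _ (F.equivFin.symm i).2
    obtain ⟨hxE', hx1', hx2', hx3'⟩ := hFp _ (F.equivFin.symm i').2
    beta_reduce
    generalize ((F.equivFin.symm i : F) : X) = x at *
    generalize ((F.equivFin.symm i' : F) : X) = x' at *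
    obtain ⟨j, hj, hd⟩ := hEs x hxE x' hxE' hxx
    refine ⟨m₁ + j, by omega, ?_⟩
    have h7 := (hc x (hEY hxE)).2.2.2.2.2.2 j hj
    have h7' := (hc x' (hEY hxE')).2.2.2.2.2.2 j hj
    rw [hx1] at h7
    rw [hx1'] at h7'
    rw [h7, h7']; exact hd
  · push_cast
    have : 0 ≤ κ * (m₁ + m₂ : ℝ) := by positivity
    nlinarith
  · refine le_trans ?_ hm
    rw [le_div_iff₀ htc]
    rw [← Real.exp_log htc, ← Real.exp_add]
    apply Real.exp_le_exp.2
    push_cast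
    nlinarith
  · have : 0 ≤ (L : ℝ) * M := by positivity
    have : 0 < (n : ℝ) * (κ / 2) := by positivity
    nlinarith


lemma core_entropy [CompactSpace X] {f : X → X} (hf : Continuous f) (hsh : ShadowingProperty f)
    {Φ : X → ℝ} (hΦ : Continuous Φ) {p : X} (hp : p ∈ ChainRecurrent f) {α₁ α₂ : ℝ}
    (hα : α₂ < α₁)
    (h1 : ∀ n : ℕ, ∃ x ∈ ChainClassOf f p, n * α₁ ≤ ∑ i ∈ Finset.range n, Φ (f^[i] x))
    (h2 : ∀ n : ℕ, ∃ x ∈ ChainClassOf f p, ∑ i ∈ Finset.range n, Φ (f^[i] x) ≤ n * α₂)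
    {ε : ℝ} (hε : 0 < ε) {e₁ : ℝ} (he₁ : 0 < e₁) :
    bowenH f (ChainClassOf f p) e₁ ≤
      bowenH f (IrregularSet f Φ ∩ Metric.thickening ε (ChainClassOf f p) ∩ ChainRecurrent f)
        (e₁ / 4) := by
  haveI : Nonempty X := ⟨p⟩
  obtain ⟨M, hM⟩ : ∃ M, ∀ x, |Φ x| ≤ M := by
    obtain ⟨M, hM⟩ := isCompact_univ.exists_bound_of_continuousOn hΦ.continuousOn
    exact ⟨M, fun x => hM x (mem_univ x)⟩
  have hM0 : 0 ≤ M := (abs_nonneg _).trans (hM p)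
  apply le_of_forall_lt_imp_le_of_dense
  intro r hr
  obtain ⟨s, hs, rfl⟩ : ∃ s : ℝ, 0 ≤ s ∧ r = ENNReal.ofReal s :=
    ⟨r.toReal, ENNReal.toReal_nonneg, (ENNReal.ofReal_toReal hr.ne_top).symm⟩
  rcases hs.eq_or_lt with rfl | hs
  · simp
  obtain ⟨r', hr1, hr2⟩ := exists_between hr
  obtain ⟨s', hs', rfl⟩ : ∃ s : ℝ, 0 ≤ s ∧ r' = ENNReal.ofReal s :=
    ⟨r'.toReal, ENNReal.toReal_nonneg, (ENNReal.ofReal_toReal hr2.ne_top).symm⟩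
  have hss : s < s' := (ENNReal.ofReal_lt_ofReal_iff_of_nonneg hs.le).1 hr1
  obtain ⟨K, hK⟩ := exists_nat_gt (s / (s' - s))
  rw [div_lt_iff₀ (by linarith)] at hK
  have hK0 : (0 : ℝ) < K := by
    by_contra h
    have : (K : ℝ) ≤ 0 := not_lt.1 h
    nlinarith
  have hK1 : 1 ≤ K := by exact_mod_cast hK0
  set γ := α₁ - α₂ with hγ
  have hγ0 : 0 < γ := by linarith
  obtain ⟨d, hd, hdΦ⟩ := Metric.uniformContinuous_iff.1
    (CompactSpace.uniformContinuous_of_continuous hΦ) (γ / (32 * (K + 1))) (by positivity)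
  set e' := min (d / 2) (min (e₁ / 4) (ε / 2)) with he'
  have he0 : 0 < e' := by positivity
  have hed : e' ≤ d / 2 := min_le_left _ _
  have hee : e' ≤ e₁ / 4 := (min_le_right _ _).trans (min_le_left _ _)
  have heε : e' ≤ ε / 2 := (min_le_right _ _).trans (min_le_right _ _)
  obtain ⟨δ, hδ, hsd⟩ := hsh e' he0
  obtain ⟨L, hL⟩ := exists_loops hf hp hδ
  have hL' : HasLoops f δ p (ChainClassOf f p) L := hL
  have hpY : p ∈ ChainClassOf f p := ⟨hp, hp⟩
  obtain ⟨RA, SA, lA, hRA, hA, hSA⟩ := high_loop (e := e₁) hM0 hM hL' (γ := γ / 8) (by positivity) h1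
  obtain ⟨RB, SB, lB, hRB, hB, hSB⟩ := low_loop (e := e₁) hM0 hM hL' (γ := γ / 8) (by positivity) h2
  obtain ⟨N, k, a, b, l, hN, hE, hba, hk, hab⟩ := entropy_loops (Φ := Φ) hM0 hM he₁ hL'
    (s := s * (K + 1) / K) (s' := s') (κ := γ / (32 * K)) (by positivity)
    (by rw [div_lt_iff₀ hK0]; nlinarith) (by positivity) hr2
  obtain ⟨lA', hA'⟩ := hA.pow hRA (RB * N)
  obtain ⟨lB', hB'⟩ := hB.pow hRB (RA * N)
  obtain ⟨l', hE'⟩ := hE.pow hN (K * RA * RB)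
  have hu := hE'.precat hA' (fun _ => ())
  have hw := hE'.precat hB' (fun _ => ())
  rw [show RA * N * RB = RB * N * RA by ring] at hw
  have hkpos : 0 < k := by
    have : (0 : ℝ) < k := (Real.exp_pos _).trans_le hk
    exact_mod_cast this
  haveI : Nonempty (Fin k) := ⟨⟨0, hkpos⟩⟩
  have hRA' : (0 : ℝ) < RA := by exact_mod_cast hRA
  have hRB' : (0 : ℝ) < RB := by exact_mod_cast hRB
  have hN' : (0 : ℝ) < N := by exact_mod_cast hN
  set T : ℝ := N * RA * RB with hT
  have hT0 : 0 < T := by positivity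
  have hxy : (RA * N : ℝ) * SB + T * (3 * γ / 4) ≤ (RB * N : ℝ) * SA := by
    have i1 := mul_le_mul_of_nonneg_left hSA (by positivity : (0 : ℝ) ≤ RB * N)
    have i2 := mul_le_mul_of_nonneg_left hSB (by positivity : (0 : ℝ) ≤ RA * N)
    have i3 : (RB * N : ℝ) * (RA * (α₁ - γ / 8)) = T * (α₁ - γ / 8) := by rw [hT]; ring
    have i4 : (RA * N : ℝ) * (RB * (α₂ + γ / 8)) = T * (α₂ + γ / 8) := by rw [hT]; ring
    rw [i3] at i1
    rw [i4] at i2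
    have : T * (α₁ - γ / 8) - T * (α₂ + γ / 8) = T * (3 * γ / 4) := by rw [hγ]; ring
    linarith
  have hTγ : 0 < T * γ := by positivity
  have hc : (K * RA * RB : ℝ) * b - (K * RA * RB : ℝ) * a ≤ T * γ / 32 := by
    have := mul_le_mul_of_nonneg_left hba (by positivity : (0 : ℝ) ≤ K * RA * RB)
    have e1 : (K * RA * RB : ℝ) * (γ / (32 * K) * N) = T * γ / 32 := by
      rw [hT]; field_simp
    linarith
  refine entropy_of_loops hf ?_ hsd (η := γ / (32 * (K + 1))) ?_ (by linarith) hs.le ?_ hu hw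
    ?_ ?_ ?_ ?_
  · have : 0 < RB * N * RA := by positivity
    omega
  · intro x y hxy
    have := hdΦ (show dist x y < d by linarith)
    rw [Real.dist_eq] at this
    exact this.le
  · rw [Fintype.card_fun, Fintype.card_fin, Fintype.card_fin]
    push_cast
    refine le_trans (le_of_eq ?_) (pow_le_pow_left₀ (Real.exp_pos _).le hk (K * RA * RB))
    rw [← Real.exp_nat_mul]
    congr 1
    push_cast
    field_simp
    ring
  · push_cast
    have : 0 < T * (3 * γ / 4) := by positivity
    linarith
  · push_cast
    have : 0 < T * (3 * γ / 4) := by positivity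
    linarith
  · push_cast
    have e2 : ((RB : ℝ) * N * RA + K * RA * RB * N) * (γ / (32 * (K + 1))) = T * γ / 32 := by
      rw [hT]; field_simp; ring
    rw [e2]
    linarith
  · intro y hy hyc hyp
    refine ⟨⟨hy, ?_⟩, hyc⟩
    rw [Metric.mem_thickening_iff]
    exact ⟨p, hpY, by linarith⟩

lemma integral_birkhoff [CompactSpace X] [MeasurableSpace X] [BorelSpace X] {f : X → X}
    (hf : Continuous f) {Φ : X → ℝ} (hΦ : Continuous Φ) {μ : Measure X} [IsProbabilityMeasure μ]
    (hμ : MeasurePreserving f μ μ) (n : ℕ) :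
    Integrable (fun x => ∑ i ∈ Finset.range n, Φ (f^[i] x)) μ ∧
    ∫ x, ∑ i ∈ Finset.range n, Φ (f^[i] x) ∂μ = n * ∫ x, Φ x ∂μ := by
  have hintg : ∀ g : X → ℝ, Continuous g → Integrable g μ := fun g hg =>
    hg.integrable_of_hasCompactSupport (HasCompactSupport.of_compactSpace g)
  refine ⟨hintg _ (continuous_finsetSum _ fun i _ => hΦ.comp (hf.iterate i)), ?_⟩
  rw [integral_finsetSum _ fun i _ => hintg (fun x => Φ (f^[i] x)) (hΦ.comp (hf.iterate i))]
  have : ∀ i, ∫ x, Φ (f^[i] x) ∂μ = ∫ x, Φ x ∂μ := by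
    intro i
    have h := hμ.iterate i
    conv_rhs => rw [← h.map_eq]
    rw [integral_map h.measurable.aemeasurable hΦ.aestronglyMeasurable]
  simp [this]

lemma exists_high [CompactSpace X] [MeasurableSpace X] [BorelSpace X] {f : X → X}
    (hf : Continuous f) {Φ : X → ℝ} (hΦ : Continuous Φ) {μ : Measure X} [IsProbabilityMeasure μ]
    (hμ : MeasurePreserving f μ μ) {Y : Set X} (hY : μ Y = 1) (n : ℕ) :
    ∃ x ∈ Y, n * ∫ x, Φ x ∂μ ≤ ∑ i ∈ Finset.range n, Φ (f^[i] x) := by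
  obtain ⟨hi, he⟩ := integral_birkhoff hf hΦ hμ n
  by_contra! h
  have hc : Continuous fun x => ∑ i ∈ Finset.range n, Φ (f^[i] x) :=
    continuous_finsetSum _ fun i _ => hΦ.comp (hf.iterate i)
  set V := {x | ∑ i ∈ Finset.range n, Φ (f^[i] x) < n * ∫ x, Φ x ∂μ} with hV
  have hVm : MeasurableSet V := (isOpen_lt hc continuous_const).measurableSet
  have hV1 : μ V = 1 := le_antisymm prob_le_one (hY ▸ measure_mono fun x hx => h x hx)
  have hV0 : μ Vᶜ = 0 := (prob_compl_eq_zero_iff hVm).2 hV1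
  obtain ⟨x, hx, hx'⟩ := exists_notMem_null_integral_le hi hV0
  have hx1 : x ∈ V := by simpa using hx
  rw [he] at hx'
  exact absurd hx1 (not_lt.2 hx')

lemma exists_low [CompactSpace X] [MeasurableSpace X] [BorelSpace X] {f : X → X}
    (hf : Continuous f) {Φ : X → ℝ} (hΦ : Continuous Φ) {μ : Measure X} [IsProbabilityMeasure μ]
    (hμ : MeasurePreserving f μ μ) {Y : Set X} (hY : μ Y = 1) (n : ℕ) :
    ∃ x ∈ Y, ∑ i ∈ Finset.range n, Φ (f^[i] x) ≤ n * ∫ x, Φ x ∂μ := by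
  obtain ⟨x, hx, h⟩ := exists_high hf (Φ := fun x => -Φ x) hΦ.neg hμ hY n
  refine ⟨x, hx, ?_⟩
  rw [integral_neg, Finset.sum_neg_distrib] at h
  linarith

lemma scale_bound {g G : ℝ → ℝ≥0∞} (h : ∀ e > 0, g e ≤ G (e / 4)) (c : ℝ) (hc : 1 < c) :
    ∀ᶠ e in 𝓝[>] (0 : ℝ), g e / ENNReal.ofReal (-Real.log e) ≤
      ENNReal.ofReal c * (G (e / 4) / ENNReal.ofReal (-Real.log (e / 4))) := by
  have h1 : Tendsto (fun e => -Real.log e) (𝓝[>] (0 : ℝ)) atTop :=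
    tendsto_neg_atBot_atTop.comp Real.tendsto_log_nhdsGT_zero
  filter_upwards [self_mem_nhdsWithin, h1.eventually_gt_atTop 0,
    h1.eventually_ge_atTop (Real.log 4 / (c - 1))] with e he hl0 hl
  have he : (0 : ℝ) < e := he
  rw [div_le_iff₀ (by linarith)] at hl
  have hlog : -Real.log (e / 4) = -Real.log e + Real.log 4 := by
    rw [Real.log_div he.ne' (by norm_num)]; ring
  have h4 : 0 < Real.log 4 := Real.log_pos (by norm_num)
  have hb : -Real.log (e / 4) ≤ c * -Real.log e := by rw [hlog]; nlinarith
  have hl4 : 0 < -Real.log (e / 4) := by rw [hlog]; linarith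
  have hA0 : ENNReal.ofReal (-Real.log e) ≠ 0 := by simpa using hl0
  have hB0 : ENNReal.ofReal (-Real.log (e / 4)) ≠ 0 := (ENNReal.ofReal_pos.2 hl4).ne'
  rw [ENNReal.div_le_iff hA0 ENNReal.ofReal_ne_top]
  calc g e ≤ G (e / 4) := h e he
    _ = G (e / 4) / ENNReal.ofReal (-Real.log (e / 4)) * ENNReal.ofReal (-Real.log (e / 4)) :=
        (ENNReal.div_mul_cancel hB0 ENNReal.ofReal_ne_top).symm
    _ ≤ G (e / 4) / ENNReal.ofReal (-Real.log (e / 4)) *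
        (ENNReal.ofReal c * ENNReal.ofReal (-Real.log e)) := by
        rw [← ENNReal.ofReal_mul (by linarith)]
        gcongr
    _ = _ := by ring

lemma map_div_four : Filter.map (fun e : ℝ => e / 4) (𝓝[>] 0) = 𝓝[>] 0 := by
  have h4 : ∀ a : ℝ, Tendsto (fun e : ℝ => e * a) (𝓝 0) (𝓝 0) := fun a => by
    have : Continuous fun e : ℝ => e * a := by fun_prop
    simpa using this.tendsto 0
  have t : ∀ a : ℝ, 0 < a → Tendsto (fun e : ℝ => e * a) (𝓝[>] 0) (𝓝[>] 0) := by
    intro a ha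
    refine tendsto_nhdsWithin_iff.2 ⟨(h4 a).mono_left nhdsWithin_le_nhds, ?_⟩
    filter_upwards [self_mem_nhdsWithin] with e he
    have he : (0 : ℝ) < e := he
    exact mul_pos he ha
  have e1 : (fun e : ℝ => e / 4) = fun e => e * (1 / 4) := by funext e; ring
  rw [e1]
  refine le_antisymm (t _ (by norm_num)) ?_
  have := Filter.map_mono (m := fun e : ℝ => e * (1 / 4)) (t 4 (by norm_num))
  rw [Filter.map_map] at this
  have e2 : ((fun e : ℝ => e * (1 / 4)) ∘ fun e : ℝ => e * 4) = id := by funext e; simp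
  rwa [e2, Filter.map_id] at this

lemma le_of_scaled {a b : ℝ≥0∞} (h : ∀ c : ℝ, 1 < c → a ≤ ENNReal.ofReal c * b) : a ≤ b := by
  have ht : Tendsto (fun c : ℝ => ENNReal.ofReal c * b) (𝓝[>] 1) (𝓝 (1 * b)) := by
    apply ENNReal.Tendsto.mul_const _ (Or.inl one_ne_zero)
    have := (ENNReal.continuous_ofReal.tendsto 1).mono_left (nhdsWithin_le_nhds (s := Ioi (1 : ℝ)))
    simpa using this
  rw [one_mul] at ht
  exact ge_of_tendsto ht (by filter_upwards [self_mem_nhdsWithin] with c hc using h c hc)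

lemma mdim_le {f : X → X} {Y Z : Set X} (h : ∀ e > 0, bowenH f Y e ≤ bowenH f Z (e / 4)) :
    upperMdim f Y ≤ upperMdim f Z ∧ lowerMdim f Y ≤ lowerMdim f Z := by
  set G : ℝ → ℝ≥0∞ := fun e => bowenH f Z e / ENNReal.ofReal (-Real.log e) with hG
  constructor
  · apply le_of_scaled
    intro c hc
    unfold upperMdim
    refine (limsup_le_limsup (scale_bound h c hc)).trans ?_
    rw [ENNReal.limsup_const_mul_of_ne_top ENNReal.ofReal_ne_top]
    gcongr
    have : limsup G (Filter.map (fun e : ℝ => e / 4) (𝓝[>] 0)) = limsup G (𝓝[>] 0) := by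
      rw [map_div_four]
    exact this.le
  · apply le_of_scaled
    intro c hc
    unfold lowerMdim
    refine (liminf_le_liminf (scale_bound h c hc)).trans ?_
    have : liminf G (Filter.map (fun e : ℝ => e / 4) (𝓝[>] 0)) = liminf G (𝓝[>] 0) := by
      rw [map_div_four]
    change liminf ((fun x => ENNReal.ofReal c * x) ∘ (G ∘ fun e => e / 4)) _ ≤ _
    have hm : Monotone fun x : ℝ≥0∞ => ENNReal.ofReal c * x := fun x y hxy => by
      dsimp only; gcongr
    have := hm.map_liminf_of_continuousAt (F := 𝓝[>] (0 : ℝ)) (G ∘ fun e => e / 4)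
      (ENNReal.continuous_const_mul ENNReal.ofReal_ne_top).continuousAt
    rw [← this]
    have : liminf G (Filter.map (fun e : ℝ => e / 4) (𝓝[>] 0)) = liminf G (𝓝[>] 0) := by
      rw [map_div_four]
    exact mul_le_mul_right this.le _

/-- Main theorem (metric mean dimension version): the upper and lower relative metric mean
dimensions of the irregular set near the chain class are at least those of the class. -/
theorem irregular_set_mdim_lower_bound [CompactSpace X]
    [MeasurableSpace X] [BorelSpace X]
    (f : X → X) (hf : Continuous f) (hsh : ShadowingProperty f)
    (Y : Set X) (hY : IsChainClass f Y)
    (Φ : X → ℝ) (hΦ : Continuous Φ)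
    (μ₁ μ₂ : Measure X)
    (h₁p : IsProbabilityMeasure μ₁) (h₂p : IsProbabilityMeasure μ₂)
    (h₁e : Ergodic f μ₁) (h₂e : Ergodic f μ₂)
    (h₁Y : μ₁ Y = 1) (h₂Y : μ₂ Y = 1)
    (hne : ∫ x, Φ x ∂μ₁ ≠ ∫ x, Φ x ∂μ₂)
    (ε : ℝ) (hε : 0 < ε) :
    upperMdim f Y ≤
      upperMdim f (IrregularSet f Φ ∩ Metric.thickening ε Y ∩ ChainRecurrent f) ∧
    lowerMdim f Y ≤
      lowerMdim f (IrregularSet f Φ ∩ Metric.thickening ε Y ∩ ChainRecurrent f) := by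
  obtain ⟨p, hp, rfl⟩ := hY
  apply mdim_le
  intro e he
  rcases lt_or_gt_of_ne hne with h | h
  · exact core_entropy hf hsh hΦ hp h (exists_high hf hΦ h₂e.toMeasurePreserving h₂Y)
      (exists_low hf hΦ h₁e.toMeasurePreserving h₁Y) hε he
  · exact core_entropy hf hsh hΦ hp h (exists_high hf hΦ h₁e.toMeasurePreserving h₁Y)
      (exists_low hf hΦ h₂e.toMeasurePreserving h₂Y) hε he
end
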